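/- arXiv:1709.09626 — 2 statements merged into one kernel-verified Lean document; each statement's English description precedes it below -/
import Mathlib

section
/- Suppose A is a finite partial plane whose free completion F(A) is infinite. Then there is a projective plane B such that A is an induced substructure of B, A generates B under I-closure, and there is no isomorphism from B to F(A) fixing A pointwise. -/
universe u v

/-- An incidence structure on the type `M`: "points" and "lines" partition `M`,
and incidence only holds between a point and a line. -/
structure IncidenceData (M : Type u) where
  pt : M → Prop
  ln : M → Prop
  inc : M → M → Prop
  pt_or_ln : ∀ z, pt z ∨ ln z
  not_pt_and_ln : ∀ z, ¬(pt z ∧ ln z)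
  inc_pt_ln : ∀ x y, inc x y → pt x ∧ ln y

/-- `K_{m,n}`-freeness: there are no `m` pairwise distinct points and `n` pairwise
distinct lines with every one of the points incident to every one of the lines. -/
def KFree (m n : ℕ) {M : Type u} (S : IncidenceData M) : Prop :=
  ¬∃ (a : Fin m → M) (b : Fin n → M),
      Function.Injective a ∧ Function.Injective b ∧
      (∀ i, S.pt (a i)) ∧ (∀ j, S.ln (b j)) ∧ ∀ i j, S.inc (a i) (b j)

/-- Membership in `T^c_{m,n}`: a `K_{m,n}`-free incidence structure in which every `m`
pairwise distinct points are simultaneously incident to exactly `n-1` pairwise distinct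
lines, and every `n` pairwise distinct lines are simultaneously incident to exactly
`m-1` pairwise distinct points. -/
def Complete (m n : ℕ) {M : Type u} (S : IncidenceData M) : Prop :=
  KFree m n S ∧
  (∀ a : Fin m → M, Function.Injective a → (∀ i, S.pt (a i)) →
    ∃ b : Fin (n - 1) → M, Function.Injective b ∧ (∀ j, S.ln (b j)) ∧
      (∀ i j, S.inc (a i) (b j)) ∧ ∀ y, S.ln y → (∀ i, S.inc (a i) y) → ∃ j, y = b j) ∧
  (∀ b : Fin n → M, Function.Injective b → (∀ j, S.ln (b j)) →
    ∃ a : Fin (m - 1) → M, Function.Injective a ∧ (∀ i, S.pt (a i)) ∧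
      (∀ i j, S.inc (a i) (b j)) ∧ ∀ x, S.pt x → (∀ j, S.inc x (b j)) → ∃ i, x = a i)

/-- An embedding of incidence structures: an injective map preserving points, lines,
incidence and non-incidence. -/
structure IncEmbedding {M : Type u} {N : Type v} (S : IncidenceData M)
    (T : IncidenceData N) where
  toFun : M → N
  inj : Function.Injective toFun
  pt_iff : ∀ x, T.pt (toFun x) ↔ S.pt x
  ln_iff : ∀ x, T.ln (toFun x) ↔ S.ln x
  inc_iff : ∀ x y, T.inc (toFun x) (toFun y) ↔ S.inc x y

/-- A subset `Y` is `I`-closed: whenever `m` pairwise distinct points of `Y` are all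
incident to an element `y` of `M`, then `y ∈ Y`, and dually for `n` pairwise distinct
lines of `Y`. -/
def IClosedD (m n : ℕ) {M : Type u} (S : IncidenceData M) (Y : Set M) : Prop :=
  (∀ (a : Fin m → M) (y : M), Function.Injective a → (∀ i, S.pt (a i)) →
    (∀ i, a i ∈ Y) → (∀ i, S.inc (a i) y) → y ∈ Y) ∧
  (∀ (b : Fin n → M) (x : M), Function.Injective b → (∀ j, S.ln (b j)) →
    (∀ j, b j ∈ Y) → (∀ j, S.inc x (b j)) → x ∈ Y)

/-- The `I`-closure of `A` in `M`: the smallest `I`-closed subset containing `A`. -/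
def iclD (m n : ℕ) {M : Type u} (S : IncidenceData M) (A : Set M) : Set M :=
  ⋂₀ {Y : Set M | IClosedD m n S Y ∧ A ⊆ Y}

/-- A projective plane: a `K_{2,2}`-free incidence structure in which any two distinct
points are both incident to exactly one common line and any two distinct lines are both
incident to exactly one common point. -/
def IsProjPlane {M : Type u} (S : IncidenceData M) : Prop :=
  KFree 2 2 S ∧
  (∀ x y, S.pt x → S.pt y → x ≠ y → ∃! z, S.inc x z ∧ S.inc y z) ∧
  (∀ x y, S.ln x → S.ln y → x ≠ y → ∃! z, S.inc z x ∧ S.inc z y)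

/-- An isomorphism of incidence structures: a bijection preserving points, lines,
incidence and non-incidence. -/
structure IncIso {M : Type u} {N : Type v} (S : IncidenceData M) (T : IncidenceData N) where
  toEquiv : M ≃ N
  pt_iff : ∀ x, T.pt (toEquiv x) ↔ S.pt x
  ln_iff : ∀ x, T.ln (toEquiv x) ↔ S.ln x
  inc_iff : ∀ x y, T.inc (toEquiv x) (toEquiv y) ↔ S.inc x y

/-- An `m`-element set `σ` of points of `Xk` which are simultaneously incident to at
most `n - 2` lines of `Xk` (i.e. it is not the case that there exist `n - 1` pairwise
distinct common lines in `Xk`). -/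
def IsDeficientPtSet (m n : ℕ) {T : Type v} (S : IncidenceData T) (Xk σ : Set T) : Prop :=
  σ ⊆ Xk ∧ (∀ x ∈ σ, S.pt x) ∧
    (∃ a : Fin m → T, Function.Injective a ∧ Set.range a = σ) ∧
    ¬∃ g : Fin (n - 1) → T, Function.Injective g ∧
        ∀ j, g j ∈ Xk ∧ S.ln (g j) ∧ ∀ x ∈ σ, S.inc x (g j)

/-- An `n`-element set `σ` of lines of `Xk` which are simultaneously incident to at
most `m - 2` points of `Xk`. -/
def IsDeficientLnSet (m n : ℕ) {T : Type v} (S : IncidenceData T) (Xk σ : Set T) : Prop :=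
  σ ⊆ Xk ∧ (∀ y ∈ σ, S.ln y) ∧
    (∃ b : Fin n → T, Function.Injective b ∧ Set.range b = σ) ∧
    ¬∃ g : Fin (m - 1) → T, Function.Injective g ∧
        ∀ i, g i ∈ Xk ∧ S.pt (g i) ∧ ∀ y ∈ σ, S.inc (g i) y

/-- `(T, e)` is a realization of the free completion `F(A)` of `A`: `T` is the union of
an increasing chain `X 0 ⊆ X 1 ⊆ ⋯` of subsets with `X 0` the image of `A`, where
`X (k+1)` is obtained from `X k` by adding, for each `m`-element set `σ` of points of
`X k` simultaneously incident to at most `n-2` lines of `X k`, exactly one new line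
whose incidences within `X (k+1)` are exactly with the elements of `σ`, and dually for
each `n`-element set of lines of `X k` simultaneously incident to at most `m-2` points
of `X k`; and every element of `X (k+1) ∖ X k` arises in one of these two ways. -/
def IsFreeCompletion (m n : ℕ) {A : Type u} {T : Type v} (SA : IncidenceData A)
    (ST : IncidenceData T) (e : IncEmbedding SA ST) : Prop :=
  ∃ X : ℕ → Set T,
    X 0 = Set.range e.toFun ∧
    (∀ k, X k ⊆ X (k + 1)) ∧
    (⋃ k, X k) = Set.univ ∧
    ∀ k,
      (∀ σ : Set T, IsDeficientPtSet m n ST (X k) σ →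
        ∃! y, y ∈ X (k + 1) ∧ y ∉ X k ∧ ST.ln y ∧ (∀ x ∈ σ, ST.inc x y) ∧
          ∀ x ∈ X (k + 1), ST.inc x y → x ∈ σ) ∧
      (∀ σ : Set T, IsDeficientLnSet m n ST (X k) σ →
        ∃! x, x ∈ X (k + 1) ∧ x ∉ X k ∧ ST.pt x ∧ (∀ y ∈ σ, ST.inc x y) ∧
          ∀ y ∈ X (k + 1), ST.inc x y → y ∈ σ) ∧
      ∀ z ∈ X (k + 1), z ∉ X k →
        (ST.ln z ∧ IsDeficientPtSet m n ST (X k) {x | x ∈ X (k + 1) ∧ ST.inc x z}) ∨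
        (ST.pt z ∧ IsDeficientLnSet m n ST (X k) {y | y ∈ X (k + 1) ∧ ST.inc z y})

/-- Clean form of the free completion chain. -/
structure FC {T : Type u} (S : IncidenceData T) (X : ℕ → Set T) : Prop where
  mono : ∀ k, X k ⊆ X (k + 1)
  cover : ∀ z, ∃ k, z ∈ X k
  addL : ∀ k x y, x ∈ X k → y ∈ X k → S.pt x → S.pt y → x ≠ y →
    (∀ z ∈ X k, S.inc x z → S.inc y z → False) →
    ∃ z ∈ X (k + 1), z ∉ X k ∧ S.inc x z ∧ S.inc y z ∧
      ∀ w ∈ X (k + 1), S.inc w z → w = x ∨ w = y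
  addP : ∀ k x y, x ∈ X k → y ∈ X k → S.ln x → S.ln y → x ≠ y →
    (∀ z ∈ X k, S.inc z x → S.inc z y → False) →
    ∃ z ∈ X (k + 1), z ∉ X k ∧ S.inc z x ∧ S.inc z y ∧
      ∀ w ∈ X (k + 1), S.inc z w → w = x ∨ w = y
  newL : ∀ k z, z ∈ X (k + 1) → z ∉ X k → S.ln z →
    ∃ x y, x ∈ X k ∧ y ∈ X k ∧ x ≠ y ∧ S.inc x z ∧ S.inc y z ∧
      (∀ w ∈ X (k + 1), S.inc w z → w = x ∨ w = y) ∧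
      (∀ w ∈ X k, S.inc x w → S.inc y w → False) ∧
      ∀ w ∈ X (k + 1), w ∉ X k → S.inc x w → S.inc y w → w = z
  newP : ∀ k z, z ∈ X (k + 1) → z ∉ X k → S.pt z →
    ∃ x y, x ∈ X k ∧ y ∈ X k ∧ x ≠ y ∧ S.inc z x ∧ S.inc z y ∧
      (∀ w ∈ X (k + 1), S.inc z w → w = x ∨ w = y) ∧
      (∀ w ∈ X k, S.inc w x → S.inc w y → False) ∧
      ∀ w ∈ X (k + 1), w ∉ X k → S.inc w x → S.inc w y → w = z

/-- `K_{2,2}`-freeness, elementary form. -/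
def NoK {T : Type u} (S : IncidenceData T) : Prop :=
  ∀ x y a b, S.inc x a → S.inc y a → S.inc x b → S.inc y b → x = y ∨ a = b

theorem kfree_iff {T : Type u} (S : IncidenceData T) : KFree 2 2 S ↔ NoK S := by
  constructor
  · intro h x y a b h1 h2 h3 h4
    by_contra hc
    push Not at hc
    refine h ⟨![x, y], ![a, b], ?_, ?_, ?_, ?_, ?_⟩
    · intro i j hij
      fin_cases i <;> fin_cases j <;> simp_all [eq_comm]
    · intro i j hij
      fin_cases i <;> fin_cases j <;> simp_all [eq_comm]
    · intro i
      fin_cases i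
      · exact (S.inc_pt_ln _ _ h1).1
      · exact (S.inc_pt_ln _ _ h2).1
    · intro i
      fin_cases i
      · exact (S.inc_pt_ln _ _ h1).2
      · exact (S.inc_pt_ln _ _ h3).2
    · intro i j
      fin_cases i <;> fin_cases j <;> simpa
  · rintro h ⟨a, b, ha, hb, -, -, hi⟩
    rcases h (a 0) (a 1) (b 0) (b 1) (hi 0 0) (hi 1 0) (hi 0 1) (hi 1 1) with h | h
    · exact absurd (ha h) (by decide)
    · exact absurd (hb h) (by decide)

theorem range_pair_iff {T : Type u} (σ : Set T) :
    (∃ a : Fin 2 → T, Function.Injective a ∧ Set.range a = σ) ↔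
      ∃ x y, x ≠ y ∧ σ = {x, y} := by
  constructor
  · rintro ⟨a, ha, rfl⟩
    refine ⟨a 0, a 1, fun h => absurd (ha h) (by decide), ?_⟩
    ext z
    simp [Fin.exists_fin_two, eq_comm]
  · rintro ⟨x, y, hxy, rfl⟩
    refine ⟨![x, y], ?_, ?_⟩
    · intro i j hij
      fin_cases i <;> fin_cases j <;> simp_all [eq_comm]
    · ext z
      simp [eq_comm, or_comm]

theorem defP_iff {T : Type u} (S : IncidenceData T) (Y σ : Set T) :
    IsDeficientPtSet 2 2 S Y σ ↔ ∃ x y, x ≠ y ∧ σ = {x, y} ∧ x ∈ Y ∧ y ∈ Y ∧ S.pt x ∧ S.pt y ∧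
      ∀ w ∈ Y, S.inc x w → S.inc y w → False := by
  unfold IsDeficientPtSet
  rw [range_pair_iff]
  constructor
  · rintro ⟨h1, h2, ⟨x, y, hxy, rfl⟩, h4⟩
    refine ⟨x, y, hxy, rfl, h1 (by simp), h1 (by simp), h2 x (by simp), h2 y (by simp), ?_⟩
    intro w hw hx hy
    refine h4 ⟨fun _ => w, fun i j _ => Subsingleton.elim (α := Fin 1) i j, fun j => ⟨hw, (S.inc_pt_ln _ _ hx).2, ?_⟩⟩
    rintro z (rfl | rfl) <;> assumption
  · rintro ⟨x, y, hxy, rfl, hx, hy, px, py, h⟩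
    refine ⟨?_, ?_, ⟨x, y, hxy, rfl⟩, ?_⟩
    · rintro z (rfl | rfl) <;> assumption
    · rintro z (rfl | rfl) <;> assumption
    · rintro ⟨g, -, hg⟩
      obtain ⟨h1, -, h3⟩ := hg (0 : Fin 1)
      exact h _ h1 (h3 x (by simp)) (h3 y (by simp))

theorem defL_iff {T : Type u} (S : IncidenceData T) (Y σ : Set T) :
    IsDeficientLnSet 2 2 S Y σ ↔ ∃ x y, x ≠ y ∧ σ = {x, y} ∧ x ∈ Y ∧ y ∈ Y ∧ S.ln x ∧ S.ln y ∧
      ∀ w ∈ Y, S.inc w x → S.inc w y → False := by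
  unfold IsDeficientLnSet
  rw [range_pair_iff]
  constructor
  · rintro ⟨h1, h2, ⟨x, y, hxy, rfl⟩, h4⟩
    refine ⟨x, y, hxy, rfl, h1 (by simp), h1 (by simp), h2 x (by simp), h2 y (by simp), ?_⟩
    intro w hw hx hy
    refine h4 ⟨fun _ => w, fun i j _ => Subsingleton.elim (α := Fin 1) i j, fun j => ⟨hw, (S.inc_pt_ln _ _ hx).1, ?_⟩⟩
    rintro z (rfl | rfl) <;> assumption
  · rintro ⟨x, y, hxy, rfl, hx, hy, px, py, h⟩
    refine ⟨?_, ?_, ⟨x, y, hxy, rfl⟩, ?_⟩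
    · rintro z (rfl | rfl) <;> assumption
    · rintro z (rfl | rfl) <;> assumption
    · rintro ⟨g, -, hg⟩
      obtain ⟨h1, -, h3⟩ := hg (0 : Fin 1)
      exact h _ h1 (h3 x (by simp)) (h3 y (by simp))

theorem pair_eq_of_mem {T : Type u} {a b x y : T} (hx : x = a ∨ x = b) (hy : y = a ∨ y = b)
    (hxy : x ≠ y) : ({a, b} : Set T) = {x, y} := by
  rcases hx with rfl | rfl <;> rcases hy with rfl | rfl <;> first | exact absurd rfl hxy | rfl | exact Set.pair_comm _ _

theorem fc_of {A T : Type u} (SA : IncidenceData A) (S : IncidenceData T) (e : IncEmbedding SA S)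
    (h : IsFreeCompletion 2 2 SA S e) : ∃ X, X 0 = Set.range e.toFun ∧ FC S X := by
  obtain ⟨X, h0, hm, hu, hk⟩ := h
  refine ⟨X, h0, hm, ?_, ?_, ?_, ?_, ?_⟩
  · intro z
    have : z ∈ ⋃ k, X k := hu ▸ Set.mem_univ z
    simpa using this
  · intro k x y hx hy px py hxy hno
    obtain ⟨z, ⟨z1, z2, z3, z4, z5⟩, -⟩ := (hk k).1 {x, y}
      ((defP_iff _ _ _).2 ⟨x, y, hxy, rfl, hx, hy, px, py, hno⟩)
    exact ⟨z, z1, z2, z4 x (by simp), z4 y (by simp), fun w hw hi => by simpa using z5 w hw hi⟩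
  · intro k x y hx hy px py hxy hno
    obtain ⟨z, ⟨z1, z2, z3, z4, z5⟩, -⟩ := (hk k).2.1 {x, y}
      ((defL_iff _ _ _).2 ⟨x, y, hxy, rfl, hx, hy, px, py, hno⟩)
    exact ⟨z, z1, z2, z4 x (by simp), z4 y (by simp), fun w hw hi => by simpa using z5 w hw hi⟩
  · intro k z hz hz' lz
    rcases (hk k).2.2 z hz hz' with ⟨-, hd⟩ | ⟨pz, -⟩
    swap
    · exact absurd ⟨pz, lz⟩ (S.not_pt_and_ln z)
    obtain ⟨x, y, hxy, hs, hx, hy, px, py, hno⟩ := (defP_iff _ _ _).1 hd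
    have hs' : ∀ w, (w ∈ X (k + 1) ∧ S.inc w z) ↔ (w = x ∨ w = y) := fun w => by
      simpa using Set.ext_iff.1 hs w
    refine ⟨x, y, hx, hy, hxy, ((hs' x).2 (.inl rfl)).2, ((hs' y).2 (.inr rfl)).2,
      fun w hw hi => (hs' w).1 ⟨hw, hi⟩, hno, ?_⟩
    intro w hw hw' hxw hyw
    obtain ⟨c, -, hc⟩ := (hk k).1 {x, y}
      ((defP_iff _ _ _).2 ⟨x, y, hxy, rfl, hx, hy, px, py, hno⟩)
    have key : ∀ w ∈ X (k + 1), w ∉ X k → S.inc x w → S.inc y w → w = c := by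
      intro w hw hw' hxw hyw
      apply hc
      refine ⟨hw, hw', (S.inc_pt_ln _ _ hxw).2, ?_, ?_⟩
      · rintro v (rfl | rfl) <;> assumption
      · rcases (hk k).2.2 w hw hw' with ⟨-, hd⟩ | ⟨pz, -⟩
        swap
        · exact absurd ⟨pz, (S.inc_pt_ln _ _ hxw).2⟩ (S.not_pt_and_ln w)
        obtain ⟨a, b, hab, hs, -⟩ := (defP_iff _ _ _).1 hd
        have hs' : ∀ v, (v ∈ X (k + 1) ∧ S.inc v w) ↔ (v = a ∨ v = b) := fun v => by
          simpa using Set.ext_iff.1 hs v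
        intro v hv hi
        rw [← pair_eq_of_mem ((hs' x).1 ⟨hm k hx, hxw⟩) ((hs' y).1 ⟨hm k hy, hyw⟩) hxy]
        exact (hs' v).1 ⟨hv, hi⟩
    rw [key w hw hw' hxw hyw, ← key z hz hz' ((hs' x).2 (.inl rfl)).2 ((hs' y).2 (.inr rfl)).2]
  · intro k z hz hz' lz
    rcases (hk k).2.2 z hz hz' with ⟨pz, -⟩ | ⟨-, hd⟩
    · exact absurd ⟨lz, pz⟩ (S.not_pt_and_ln z)
    obtain ⟨x, y, hxy, hs, hx, hy, px, py, hno⟩ := (defL_iff _ _ _).1 hd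
    have hs' : ∀ w, (w ∈ X (k + 1) ∧ S.inc z w) ↔ (w = x ∨ w = y) := fun w => by
      simpa using Set.ext_iff.1 hs w
    refine ⟨x, y, hx, hy, hxy, ((hs' x).2 (.inl rfl)).2, ((hs' y).2 (.inr rfl)).2,
      fun w hw hi => (hs' w).1 ⟨hw, hi⟩, hno, ?_⟩
    intro w hw hw' hxw hyw
    obtain ⟨c, -, hc⟩ := (hk k).2.1 {x, y}
      ((defL_iff _ _ _).2 ⟨x, y, hxy, rfl, hx, hy, px, py, hno⟩)
    have key : ∀ w ∈ X (k + 1), w ∉ X k → S.inc w x → S.inc w y → w = c := by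
      intro w hw hw' hxw hyw
      apply hc
      refine ⟨hw, hw', (S.inc_pt_ln _ _ hxw).1, ?_, ?_⟩
      · rintro v (rfl | rfl) <;> assumption
      · rcases (hk k).2.2 w hw hw' with ⟨pz, -⟩ | ⟨-, hd⟩
        · exact absurd ⟨(S.inc_pt_ln _ _ hxw).1, pz⟩ (S.not_pt_and_ln w)
        obtain ⟨a, b, hab, hs, -⟩ := (defL_iff _ _ _).1 hd
        have hs' : ∀ v, (v ∈ X (k + 1) ∧ S.inc w v) ↔ (v = a ∨ v = b) := fun v => by
          simpa using Set.ext_iff.1 hs v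
        intro v hv hi
        rw [← pair_eq_of_mem ((hs' x).1 ⟨hm k hx, hxw⟩) ((hs' y).1 ⟨hm k hy, hyw⟩) hxy]
        exact (hs' v).1 ⟨hv, hi⟩
    rw [key w hw hw' hxw hyw, ← key z hz hz' ((hs' x).2 (.inl rfl)).2 ((hs' y).2 (.inr rfl)).2]

namespace FC

variable {T : Type u} {S : IncidenceData T} {X : ℕ → Set T}

theorem mono_le (h : FC S X) {i j : ℕ} (hij : i ≤ j) : X i ⊆ X j :=
  monotone_nat_of_le_succ h.mono hij

/-- every element outside `X K` appears at some later stage -/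
theorem born (h : FC S X) (K : ℕ) (z : T) (hz : z ∉ X K) :
    ∃ k, K ≤ k ∧ z ∈ X (k + 1) ∧ z ∉ X k := by
  classical
  have hex := h.cover z
  have h1 := Nat.find_spec hex
  have hlt : K < Nat.find hex := by
    by_contra hc
    exact hz (h.mono_le (not_lt.1 hc) h1)
  obtain ⟨k, hk⟩ : ∃ k, Nat.find hex = k + 1 := ⟨Nat.find hex - 1, by omega⟩
  refine ⟨k, by omega, hk ▸ h1, Nat.find_min hex (by omega)⟩

theorem noK (h : FC S X) (h0 : ∀ x ∈ X 0, ∀ y ∈ X 0, ∀ a ∈ X 0, ∀ b ∈ X 0,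
    S.inc x a → S.inc y a → S.inc x b → S.inc y b → x = y ∨ a = b) : NoK S := by
  have key : ∀ k, ∀ x ∈ X k, ∀ y ∈ X k, ∀ a ∈ X k, ∀ b ∈ X k,
    S.inc x a → S.inc y a → S.inc x b → S.inc y b → x = y ∨ a = b := by
    intro k
    induction k with
    | zero => exact h0
    | succ k ih =>
      have hL : ∀ x ∈ X (k+1), ∀ y ∈ X (k+1), ∀ a ∈ X (k+1), ∀ b ∈ X (k+1),
          S.inc x a → S.inc y a → S.inc x b → S.inc y b → a ∉ X k → x = y ∨ a = b := by
        intro x hx y hy a ha b hb h1 h2 h3 h4 hn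
        obtain ⟨p, q, hp, hq, hpq, hpa, hqa, hall, hno, huniq⟩ := h.newL k a ha hn (S.inc_pt_ln _ _ h1).2
        have := hall x hx h1
        have := hall y hy h2
        have := hno b
        have := huniq b hb
        grind
      have hP : ∀ x ∈ X (k+1), ∀ y ∈ X (k+1), ∀ a ∈ X (k+1), ∀ b ∈ X (k+1),
          S.inc x a → S.inc y a → S.inc x b → S.inc y b → x ∉ X k → x = y ∨ a = b := by
        intro x hx y hy a ha b hb h1 h2 h3 h4 hn
        obtain ⟨p, q, hp, hq, hpq, hpa, hqa, hall, hno, huniq⟩ := h.newP k x hx hn (S.inc_pt_ln _ _ h1).1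
        have := hall a ha h1
        have := hall b hb h3
        have := hno y
        have := huniq y hy
        grind
      intro x hx y hy a ha b hb h1 h2 h3 h4
      by_cases hxk : x ∈ X k
      · by_cases hyk : y ∈ X k
        · by_cases hak : a ∈ X k
          · by_cases hbk : b ∈ X k
            · exact ih x hxk y hyk a hak b hbk h1 h2 h3 h4
            · exact (hL x hx y hy b hb a ha h3 h4 h1 h2 hbk).imp id Eq.symm
          · exact hL x hx y hy a ha b hb h1 h2 h3 h4 hak
        · exact (hP y hy x hx a ha b hb h2 h1 h4 h3 hyk).imp Eq.symm id
      · exact hP x hx y hy a ha b hb h1 h2 h3 h4 hxk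
  intro x y a b
  obtain ⟨i, hi⟩ := h.cover x
  obtain ⟨j, hj⟩ := h.cover y
  obtain ⟨k, hk⟩ := h.cover a
  obtain ⟨l, hl⟩ := h.cover b
  exact key (i + j + k + l) x (h.mono_le (by omega) hi) y (h.mono_le (by omega) hj)
    a (h.mono_le (by omega) hk) b (h.mono_le (by omega) hl)

theorem joins (h : FC S X) {x y : T} (px : S.pt x) (py : S.pt y) (hxy : x ≠ y) :
    ∃ z, S.inc x z ∧ S.inc y z := by
  by_contra hc
  push Not at hc
  obtain ⟨i, hi⟩ := h.cover x
  obtain ⟨j, hj⟩ := h.cover y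
  obtain ⟨z, -, -, h1, h2, -⟩ := h.addL (i + j) x y (h.mono_le (by omega) hi)
    (h.mono_le (by omega) hj) px py hxy (fun z _ h1 h2 => hc z h1 h2)
  exact hc z h1 h2

end FC

/-- lines joining two points of a finite set form a finite set -/
theorem fin_joins {T : Type u} {S : IncidenceData T} (hK : NoK S) {F : Set T} (hF : F.Finite) :
    {z | ∃ x ∈ F, ∃ y ∈ F, x ≠ y ∧ S.inc x z ∧ S.inc y z}.Finite := by
  have : {z | ∃ x ∈ F, ∃ y ∈ F, x ≠ y ∧ S.inc x z ∧ S.inc y z} ⊆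
      ⋃ x ∈ F, ⋃ y ∈ F, {z | x ≠ y ∧ S.inc x z ∧ S.inc y z} := by
    rintro z ⟨x, hx, y, hy, hz⟩
    simp only [Set.mem_iUnion]
    exact ⟨x, hx, y, hy, hz⟩
  refine Set.Finite.subset (hF.biUnion fun x _ => hF.biUnion fun y _ => ?_) this
  apply Set.Subsingleton.finite
  rintro z ⟨h1, h2, h3⟩ w ⟨-, h5, h6⟩
  exact (hK x y z w h2 h3 h5 h6).resolve_left h1

theorem fin_meets {T : Type u} {S : IncidenceData T} (hK : NoK S) {F : Set T} (hF : F.Finite) :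
    {z | ∃ x ∈ F, ∃ y ∈ F, x ≠ y ∧ S.inc z x ∧ S.inc z y}.Finite := by
  have : {z | ∃ x ∈ F, ∃ y ∈ F, x ≠ y ∧ S.inc z x ∧ S.inc z y} ⊆
      ⋃ x ∈ F, ⋃ y ∈ F, {z | x ≠ y ∧ S.inc z x ∧ S.inc z y} := by
    rintro z ⟨x, hx, y, hy, hz⟩
    simp only [Set.mem_iUnion]
    exact ⟨x, hx, y, hy, hz⟩
  refine Set.Finite.subset (hF.biUnion fun x _ => hF.biUnion fun y _ => ?_) this
  apply Set.Subsingleton.finite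
  rintro z ⟨h1, h2, h3⟩ w ⟨-, h5, h6⟩
  exact (hK z w x y h2 h5 h3 h6).resolve_right h1

namespace FC

variable {T : Type u} {S : IncidenceData T} {X : ℕ → Set T}

theorem fin (h : FC S X) (hK : NoK S) (h0 : (X 0).Finite) (k : ℕ) : (X k).Finite := by
  induction k with
  | zero => exact h0
  | succ k ih =>
    refine ((ih.union (fin_joins hK ih)).union (fin_meets hK ih)).subset ?_
    intro z hz
    by_cases hzk : z ∈ X k
    · exact .inl (.inl hzk)
    rcases S.pt_or_ln z with p | l
    · obtain ⟨x, y, hx, hy, hxy, h1, h2, -⟩ := h.newP k z hz hzk p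
      exact .inr ⟨x, hx, y, hy, hxy, h1, h2⟩
    · obtain ⟨x, y, hx, hy, hxy, h1, h2, -⟩ := h.newL k z hz hzk l
      exact .inl (.inr ⟨x, hx, y, hy, hxy, h1, h2⟩)

theorem inf_of (h : FC S X) (hK : NoK S) (h0 : (X 0).Finite) [Infinite T] :
    {z | S.pt z}.Infinite ∧ {z | S.ln z}.Infinite := by
  have hL : {z | S.pt z}.Finite → {z | S.ln z}.Finite := by
    intro hf
    refine (h0.union (fin_joins hK hf)).subset ?_
    intro z hz
    by_cases hz0 : z ∈ X 0
    · exact .inl hz0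
    obtain ⟨k, -, hk1, hk2⟩ := h.born 0 z hz0
    obtain ⟨x, y, hx, hy, hxy, h1, h2, -⟩ := h.newL k z hk1 hk2 hz
    exact .inr ⟨x, (S.inc_pt_ln _ _ h1).1, y, (S.inc_pt_ln _ _ h2).1, hxy, h1, h2⟩
  have hP : {z | S.ln z}.Finite → {z | S.pt z}.Finite := by
    intro hf
    refine (h0.union (fin_meets hK hf)).subset ?_
    intro z hz
    by_cases hz0 : z ∈ X 0
    · exact .inl hz0
    obtain ⟨k, -, hk1, hk2⟩ := h.born 0 z hz0
    obtain ⟨x, y, hx, hy, hxy, h1, h2, -⟩ := h.newP k z hk1 hk2 hz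
    exact .inr ⟨x, (S.inc_pt_ln _ _ h1).2, y, (S.inc_pt_ln _ _ h2).2, hxy, h1, h2⟩
  have hU : ¬ ({z | S.pt z}.Finite ∧ {z | S.ln z}.Finite) := by
    rintro ⟨h1, h2⟩
    refine Set.infinite_univ (α := T) ((h1.union h2).subset fun z _ => S.pt_or_ln z)
  constructor
  · intro hf
    exact hU ⟨hf, hL hf⟩
  · intro hf
    exact hU ⟨hP hf, hf⟩

theorem heavy_inf (h : FC S X) (hK : NoK S) (h0 : (X 0).Finite) [Infinite T] :
    {u | S.pt u ∧ {z | S.inc u z}.Infinite}.Infinite := by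
  intro hfin
  obtain ⟨hPi, hLi⟩ := h.inf_of hK h0
  obtain ⟨x, hx, hxl⟩ := (hPi.sdiff hfin).nonempty
  have hxf : {z | S.inc x z}.Finite := by
    by_contra hc
    exact hxl ⟨hx, hc⟩
  -- some line through `x` has infinitely many points
  obtain ⟨l, hl⟩ : ∃ l, {y | S.inc y l}.Infinite := by
    by_contra hc
    push Not at hc
    apply hPi
    refine ((hxf.biUnion fun z _ => hc z).union (Set.finite_singleton x)).subset ?_
    intro y hy
    by_cases hyx : y = x
    · exact .inr hyx
    obtain ⟨z, h1, h2⟩ := h.joins hx hy (Ne.symm hyx)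
    left
    simp only [Set.mem_iUnion]
    exact ⟨z, h1, h2⟩
  have hoff : {y | S.pt y ∧ ¬ S.inc y l}.Finite := by
    refine hfin.subset ?_
    rintro y ⟨py, hy⟩
    refine ⟨py, ?_⟩
    have : ∀ w, S.inc w l → ∃ z, S.inc y z ∧ S.inc w z := fun w hw =>
      h.joins py (S.inc_pt_ln _ _ hw).1 (fun hc => hy (hc ▸ hw))
    choose! f hf1 hf2 using this
    refine Set.infinite_of_injOn_mapsTo (f := f) (s := {w | S.inc w l}) ?_ (fun w hw => hf1 w hw) hl
    intro w hw v hv hwv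
    rcases hK w v l (f w) hw hv (hf2 w hw) (hwv ▸ hf2 v hv) with h | h
    · exact h
    · exact absurd (h ▸ hf1 w hw) hy
  apply hl
  refine (h0.union (((h0.union (fin_joins hK hoff))).biUnion
    (t := fun m => {y | m ≠ l ∧ S.inc y l ∧ S.inc y m}) fun m _ => ?_)).subset ?_
  · apply Set.Subsingleton.finite
    rintro z ⟨h1, h2, h3⟩ w ⟨-, h5, h6⟩
    exact (hK z w m l h3 h6 h2 h5).resolve_right h1
  intro y hy
  by_cases hy0 : y ∈ X 0
  · exact .inl hy0
  right
  obtain ⟨k, -, hk1, hk2⟩ := h.born 0 y hy0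
  obtain ⟨a, b, ha, hb, hab, h1, h2, -⟩ := h.newP k y hk1 hk2 (S.inc_pt_ln _ _ hy).1
  obtain ⟨m, hm, hml, hym⟩ : ∃ m ∈ X k, m ≠ l ∧ S.inc y m := by
    by_cases hal : a = l
    · exact ⟨b, hb, fun hc => hab (hal.trans hc.symm), h2⟩
    · exact ⟨a, ha, hal, h1⟩
  simp only [Set.mem_iUnion]
  refine ⟨m, ?_, hml, hy, hym⟩
  by_cases hm0 : m ∈ X 0
  · exact .inl hm0
  right
  obtain ⟨j, -, hj1, hj2⟩ := h.born 0 m hm0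
  have hjk : j ≤ k := by
    by_contra hc
    exact hj2 (h.mono_le (by omega) hm)
  obtain ⟨p, q, hp, hq, hpq, hpm, hqm, -⟩ := h.newL j m hj1 hj2 (S.inc_pt_ln _ _ hym).2
  have off : ∀ r ∈ X j, S.inc r m → S.pt r ∧ ¬ S.inc r l := by
    intro r hr hrm
    refine ⟨(S.inc_pt_ln _ _ hrm).1, fun hrl => ?_⟩
    rcases hK r y m l hrm hym hrl hy with h' | h'
    · exact hk2 (h' ▸ h.mono_le hjk hr)
    · exact hml h'
  exact ⟨p, off p hp hpm, q, off q hq hqm, hpq, hpm, hqm⟩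

theorem fin_in (h : FC S X) (F : Finset T) : ∃ K, ∀ z ∈ F, z ∈ X K := by
  classical
  induction F using Finset.induction_on with
  | empty => exact ⟨0, by simp⟩
  | insert a F _ ih =>
    obtain ⟨K, hK⟩ := ih
    obtain ⟨j, hj⟩ := h.cover a
    refine ⟨K + j, fun z hz => ?_⟩
    rcases Finset.mem_insert.1 hz with rfl | hz
    · exact h.mono_le (by omega) hj
    · exact h.mono_le (by omega) (hK z hz)

theorem three_lines (h : FC S X) (hK : NoK S) (h0 : (X 0).Finite) [Infinite T] :
    ∃ k, ∃ n : Fin 3 → T, (∀ i, n i ∈ X k ∧ S.ln (n i)) ∧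
      ∀ i j, i ≠ j → n i ≠ n j ∧ ∀ w ∈ X k, S.inc w (n i) → S.inc w (n j) → False := by
  classical
  obtain ⟨U, hU, hUc⟩ := (h.heavy_inf hK h0).exists_subset_card_eq 3
  have hH : ∀ u ∈ U, ∃ H : Finset T, (∀ z ∈ H, S.inc u z) ∧ H.card = 8 := by
    intro u hu
    obtain ⟨H, hH, hc⟩ := (hU hu).2.exists_subset_card_eq 8
    exact ⟨H, fun z hz => hH hz, hc⟩
  choose! H hH1 hH2 using hH
  obtain ⟨Q, hQ, hQc⟩ := (h.inf_of hK h0).1.exists_subset_card_eq 6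
  obtain ⟨K, hKm⟩ := h.fin_in (U ∪ U.biUnion H ∪ Q)
  obtain ⟨l, hl, hlK⟩ := ((h.inf_of hK h0).2.sdiff (h.fin hK h0 K)).nonempty
  obtain ⟨k, hKk, hl1, hl2⟩ := h.born K l hlK
  obtain ⟨s, t, hs, ht, hst, hsl, htl, hall, -, -⟩ := h.newL k l hl1 hl2 hl
  have inK : ∀ z ∈ U ∪ U.biUnion H ∪ Q, z ∈ X k := fun z hz => h.mono_le hKk (hKm z hz)
  obtain ⟨u, hu⟩ : (U \ {s, t}).Nonempty := by
    rw [← Finset.card_pos]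
    have := Finset.le_card_sdiff {s, t} U
    have := Finset.card_le_two (a := s) (b := t)
    omega
  simp only [Finset.mem_sdiff, Finset.mem_insert, Finset.mem_singleton, not_or] at hu
  obtain ⟨huU, hus, hut⟩ := hu
  obtain ⟨x, hx⟩ : ∃ x : Fin 3 ↪ T, ∀ i, x i ∈ Q \ {u, s, t} := by
    have h1 := Finset.le_card_sdiff {u, s, t} Q
    have h2 := Finset.card_le_three (a := u) (b := s) (c := t)
    obtain ⟨Q', hQ', hc⟩ := Finset.exists_subset_card_eq (show 3 ≤ (Q \ {u, s, t}).card by omega)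
    refine ⟨(Q'.equivFinOfCardEq hc).symm.toEmbedding.trans (Function.Embedding.subtype _), ?_⟩
    intro i
    exact hQ' ((Q'.equivFinOfCardEq hc).symm i).2
  simp only [Finset.mem_sdiff, Finset.mem_insert, Finset.mem_singleton, not_or] at hx
  set D : Finset T := {s, t} ∪ Finset.univ.map x with hD
  have hDu : ∀ d ∈ D, d ≠ u := by
    intro d hd
    rw [hD, Finset.mem_union] at hd
    rcases hd with hd | hd
    · grind
    · obtain ⟨i, -, rfl⟩ := Finset.mem_map.1 hd
      exact (hx i).2.1
  have hbad : (D.biUnion fun d => (H u).filter fun z => S.inc d z).card ≤ 5 * 1 := by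
    refine (Finset.card_biUnion_le_card_mul _ _ 1 ?_).trans (Nat.mul_le_mul_right _ ?_)
    · intro d hd
      rw [Finset.card_le_one]
      intro a ha b hb
      rw [Finset.mem_filter] at ha hb
      exact (hK d u a b ha.2 (hH1 u huU a ha.1) hb.2 (hH1 u huU b hb.1)).resolve_left (hDu d hd)
    · refine (Finset.card_union_le _ _).trans ?_
      have := Finset.card_le_two (a := s) (b := t)
      simp only [Finset.card_map, Finset.card_univ, Fintype.card_fin]
      omega
  obtain ⟨e, he⟩ : ∃ e : Fin 3 ↪ T, ∀ i, e i ∈ H u ∧ ∀ d ∈ D, ¬ S.inc d (e i) := by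
    have h1 := Finset.le_card_sdiff (D.biUnion fun d => (H u).filter fun z => S.inc d z) (H u)
    have h2 := hH2 u huU
    obtain ⟨Q', hQ', hc⟩ := Finset.exists_subset_card_eq
      (show 3 ≤ (H u \ (D.biUnion fun d => (H u).filter fun z => S.inc d z)).card by omega)
    refine ⟨(Q'.equivFinOfCardEq hc).symm.toEmbedding.trans (Function.Embedding.subtype _), ?_⟩
    intro i
    have h3 := hQ' ((Q'.equivFinOfCardEq hc).symm i).2
    rw [Finset.mem_sdiff] at h3
    refine ⟨h3.1, fun d hd hi => h3.2 ?_⟩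
    rw [Finset.mem_biUnion]
    exact ⟨d, hd, Finset.mem_filter.2 ⟨h3.1, hi⟩⟩
  have hek : ∀ i, e i ∈ X k := fun i => inK _ (by
    simp only [Finset.mem_union, Finset.mem_biUnion]
    exact .inl (.inr ⟨u, huU, (he i).1⟩))
  have hxk : ∀ i, x i ∈ X k := fun i => inK _ (by
    simp only [Finset.mem_union]
    exact .inr (hx i).1)
  have hxe : ∀ i j, ¬ S.inc (x i) (e j) := fun i j => (he j).2 _ (by simp [hD])
  have hse : ∀ j, ¬ S.inc s (e j) := fun j => (he j).2 _ (by simp [hD])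
  have hte : ∀ j, ¬ S.inc t (e j) := fun j => (he j).2 _ (by simp [hD])
  have hle : ∀ i, e i ≠ l := fun i hc => hl2 (hc ▸ hek i)
  have hq : ∀ i, ∃ q ∈ X (k + 1 + 1), q ∉ X (k + 1) ∧ S.inc q l ∧ S.inc q (e i) ∧
      ∀ w ∈ X (k + 1 + 1), S.inc q w → w = l ∨ w = e i := by
    intro i
    refine h.addP (k + 1) l (e i) hl1 (h.mono k (hek i)) hl
      (S.inc_pt_ln _ _ (hH1 u huU _ (he i).1)).2 (hle i).symm ?_
    intro z hz h1 h2
    rcases hall z hz h1 with rfl | rfl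
    · exact hse i h2
    · exact hte i h2
  choose q hq1 hq2 hq3 hq4 hq5 using hq
  have hxl : ∀ i, ¬ S.inc (x i) l := by
    intro i hc
    rcases hall _ (h.mono k (hxk i)) hc with h' | h'
    · exact (hx i).2.2.1 h'
    · exact (hx i).2.2.2 h'
  have hxq : ∀ i j, x i ≠ q j := fun i j hc => hq2 j (hc ▸ h.mono k (hxk i))
  have hqq : ∀ i j, i ≠ j → q i ≠ q j := by
    intro i j hij hc
    rcases hq5 i (e j) (h.mono_le (by omega) (hek j)) (hc ▸ hq4 j) with h' | h'
    · exact hle j h'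
    · exact hij (e.injective h').symm
  have hn : ∀ i, ∃ n ∈ X (k + 2 + 1), n ∉ X (k + 2) ∧ S.inc (x i) n ∧ S.inc (q i) n ∧
      ∀ w ∈ X (k + 2 + 1), S.inc w n → w = x i ∨ w = q i := by
    intro i
    refine h.addL (k + 2) (x i) (q i) (h.mono_le (by omega) (hxk i)) (hq1 i) (hQ (hx i).1)
      (S.inc_pt_ln _ _ (hq3 i)).1 (hxq i i) ?_
    intro z hz h1 h2
    rcases hq5 i z hz h2 with rfl | rfl
    · exact hxl i h1
    · exact hxe i i h1
  choose n hn1 hn2 hn3 hn4 hn5 using hn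
  refine ⟨k + 2 + 1, n, fun i => ⟨hn1 i, (S.inc_pt_ln _ _ (hn3 i)).2⟩, ?_⟩
  intro i j hij
  have hno : ∀ w ∈ X (k + 2 + 1), S.inc w (n i) → S.inc w (n j) → False := by
    intro w hw h1 h2
    rcases hn5 i w hw h1 with rfl | rfl <;> rcases hn5 j _ hw h2 with h' | h'
    · exact hij (x.injective h')
    · exact hxq _ _ h'
    · exact hxq _ _ h'.symm
    · exact hqq i j hij h'
  refine ⟨fun hc => ?_, hno⟩
  exact hno (x i) (h.mono_le (by omega) (hxk i)) (hn3 i) (hc ▸ hn3 i)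

/-- three lines pairwise non-meeting at stage `k` are not concurrent -/
theorem not_conc (h : FC S X) {k : ℕ} {n : Fin 3 → T} (hn : ∀ i, n i ∈ X k ∧ S.ln (n i))
    (hd : ∀ i j, i ≠ j → n i ≠ n j ∧ ∀ w ∈ X k, S.inc w (n i) → S.inc w (n j) → False) (z : T)
    (hz : ∀ i, S.inc z (n i)) : False := by
  have hzk : z ∉ X k := fun hc => (hd 0 1 (by decide)).2 z hc (hz 0) (hz 1)
  obtain ⟨j, hj, hj1, hj2⟩ := h.born k z hzk
  obtain ⟨a, b, -, -, -, -, -, hall, -⟩ := h.newP j z hj1 hj2 (S.inc_pt_ln _ _ (hz 0)).1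
  have h' : ∀ i, n i = a ∨ n i = b := fun i => hall _ (h.mono_le (by omega) (hn i).1) (hz i)
  have h0 := h' 0
  have h1 := h' 1
  have h2 := h' 2
  have h01 := (hd 0 1 (by decide)).1
  have h02 := (hd 0 2 (by decide)).1
  have h12 := (hd 1 2 (by decide)).1
  grind

end FC

/-- A triple (points, lines, incidences) inside an ambient type. -/
abbrev Tri (U : Type u) := Set U × Set U × Set (U × U)

/-- closed subsets for an incidence set -/
def Cl {U : Type u} (I : Set (U × U)) (Y : Set U) : Prop :=
  (∀ x y a, x ≠ y → (x, a) ∈ I → (y, a) ∈ I → x ∈ Y → y ∈ Y → a ∈ Y) ∧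
  (∀ x a b, a ≠ b → (x, a) ∈ I → (x, b) ∈ I → a ∈ Y → b ∈ Y → x ∈ Y)

theorem Cl.anti {U : Type u} {I J : Set (U × U)} {Y : Set U} (h : Cl J Y) (hIJ : I ⊆ J) :
    Cl I Y :=
  ⟨fun x y a h1 h2 h3 => h.1 x y a h1 (hIJ h2) (hIJ h3),
   fun x a b h1 h2 h3 => h.2 x a b h1 (hIJ h2) (hIJ h3)⟩

/-- partial planes in the ambient type, generated by `A0`, with no incidences on `A0`
other than those allowed by `R`. -/
structure Good {U : Type u} (A0 : Set U) (R : U → U → Prop) (D : Tri U) : Prop where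
  disj : ∀ z, z ∈ D.1 → z ∉ D.2.1
  sub : ∀ x y, (x, y) ∈ D.2.2 → x ∈ D.1 ∧ y ∈ D.2.1
  noK : ∀ x y a b, (x, a) ∈ D.2.2 → (y, a) ∈ D.2.2 → (x, b) ∈ D.2.2 → (y, b) ∈ D.2.2 →
    x = y ∨ a = b
  ind : ∀ a ∈ A0, ∀ b ∈ A0, (a, b) ∈ D.2.2 → R a b
  base : ∀ a ∈ A0, a ∈ D.1 ∨ a ∈ D.2.1
  gen : ∀ z, z ∈ D.1 ∨ z ∈ D.2.1 → ∀ Y, Cl D.2.2 Y → A0 ⊆ Y → z ∈ Y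

namespace Good

variable {U : Type u} {A0 : Set U} {R : U → U → Prop}

/-- one closure step -/
def step (I : Set (U × U)) (Y : Set U) : Set U :=
  Y ∪ {a | ∃ x ∈ Y, ∃ y ∈ Y, x ≠ y ∧ (x, a) ∈ I ∧ (y, a) ∈ I} ∪
    {x | ∃ a ∈ Y, ∃ b ∈ Y, a ≠ b ∧ (x, a) ∈ I ∧ (x, b) ∈ I}

theorem countable {D : Tri U} (h : Good A0 R D) (hA : A0.Countable) :
    {z | z ∈ D.1 ∨ z ∈ D.2.1}.Countable := by
  let Y : ℕ → Set U := fun n => (step D.2.2)^[n] A0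
  have hY : ∀ n, Y (n + 1) = step D.2.2 (Y n) := fun n => Function.iterate_succ_apply' _ _ _
  have hmono : Monotone Y := monotone_nat_of_le_succ fun n => by
    rw [hY]
    exact fun z hz => .inl (.inl hz)
  have hc : ∀ n, (Y n).Countable := by
    intro n
    induction n with
    | zero => exact hA
    | succ n ih =>
      rw [hY]
      refine (ih.union ?_).union ?_
      · have : {a | ∃ x ∈ Y n, ∃ y ∈ Y n, x ≠ y ∧ (x, a) ∈ D.2.2 ∧ (y, a) ∈ D.2.2} ⊆
            ⋃ x ∈ Y n, ⋃ y ∈ Y n, {a | x ≠ y ∧ (x, a) ∈ D.2.2 ∧ (y, a) ∈ D.2.2} := by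
          rintro z ⟨x, hx, y, hy, hz⟩
          simp only [Set.mem_iUnion]
          exact ⟨x, hx, y, hy, hz⟩
        refine Set.Countable.mono this (ih.biUnion fun x _ => ih.biUnion fun y _ => ?_)
        apply Set.Subsingleton.countable
        rintro z ⟨h1, h2, h3⟩ w ⟨-, h5, h6⟩
        exact (h.noK x y z w h2 h3 h5 h6).resolve_left h1
      · have : {z | ∃ x ∈ Y n, ∃ y ∈ Y n, x ≠ y ∧ (z, x) ∈ D.2.2 ∧ (z, y) ∈ D.2.2} ⊆
            ⋃ x ∈ Y n, ⋃ y ∈ Y n, {z | x ≠ y ∧ (z, x) ∈ D.2.2 ∧ (z, y) ∈ D.2.2} := by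
          rintro z ⟨x, hx, y, hy, hz⟩
          simp only [Set.mem_iUnion]
          exact ⟨x, hx, y, hy, hz⟩
        refine Set.Countable.mono this (ih.biUnion fun x _ => ih.biUnion fun y _ => ?_)
        apply Set.Subsingleton.countable
        rintro z ⟨h1, h2, h3⟩ w ⟨-, h5, h6⟩
        exact (h.noK z w x y h2 h5 h3 h6).resolve_right h1
  refine Set.Countable.mono ?_ (Set.countable_iUnion hc)
  intro z hz
  refine h.gen z hz _ ⟨?_, ?_⟩ (fun a ha => Set.mem_iUnion.2 ⟨0, ha⟩)
  · intro x y a hxy h1 h2 hx hy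
    obtain ⟨i, hi⟩ := Set.mem_iUnion.1 hx
    obtain ⟨j, hj⟩ := Set.mem_iUnion.1 hy
    refine Set.mem_iUnion.2 ⟨i + j + 1, ?_⟩
    rw [hY]
    exact .inl (.inr ⟨x, hmono (Nat.le_add_right i j) hi, y, hmono (Nat.le_add_left j i) hj, hxy, h1, h2⟩)
  · intro x a b hab h1 h2 hx hy
    obtain ⟨i, hi⟩ := Set.mem_iUnion.1 hx
    obtain ⟨j, hj⟩ := Set.mem_iUnion.1 hy
    refine Set.mem_iUnion.2 ⟨i + j + 1, ?_⟩
    rw [hY]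
    exact .inr ⟨a, hmono (Nat.le_add_right i j) hi, b, hmono (Nat.le_add_left j i) hj, hab, h1, h2⟩

theorem addLine {D : Tri U} (h : Good A0 R D) {x y c : U} (hx : x ∈ D.1) (hy : y ∈ D.1)
    (hxy : x ≠ y) (hno : ∀ z, (x, z) ∈ D.2.2 → (y, z) ∈ D.2.2 → False)
    (hc1 : c ∉ D.1) (hc2 : c ∉ D.2.1) :
    Good A0 R (D.1, insert c D.2.1, insert (x, c) (insert (y, c) D.2.2)) := by
  have hcI : ∀ z, (z, c) ∉ D.2.2 := fun z hz => hc2 (h.sub _ _ hz).2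
  refine ⟨?_, ?_, ?_, ?_, ?_, ?_⟩
  · rintro z hz (rfl | hz')
    · exact hc1 hz
    · exact h.disj z hz hz'
  · intro p q hpq
    simp only [Set.mem_insert_iff, Prod.mk.injEq] at hpq ⊢
    rcases hpq with ⟨rfl, rfl⟩ | ⟨rfl, rfl⟩ | hpq
    · exact ⟨hx, .inl rfl⟩
    · exact ⟨hy, .inl rfl⟩
    · exact ⟨(h.sub _ _ hpq).1, .inr (h.sub _ _ hpq).2⟩
  · intro p q a b h1 h2 h3 h4
    simp only [Set.mem_insert_iff, Prod.mk.injEq] at h1 h2 h3 h4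
    have := h.noK p q a b
    have := hno a
    have := hno b
    grind
  · intro a ha b hb hab
    simp only [Set.mem_insert_iff, Prod.mk.injEq] at hab
    rcases hab with ⟨rfl, rfl⟩ | ⟨rfl, rfl⟩ | hab
    · exact absurd (h.base _ hb) (by tauto)
    · exact absurd (h.base _ hb) (by tauto)
    · exact h.ind a ha b hb hab
  · intro a ha
    exact (h.base a ha).imp id .inr
  · intro z hz Y hY hA
    have hY' : Cl D.2.2 Y := hY.anti (fun p hp => .inr (.inr hp))
    by_cases hzc : z = c
    · subst hzc
      exact hY.1 x y z hxy (.inl rfl) (.inr (.inl rfl)) (h.gen x (.inl hx) Y hY' hA)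
        (h.gen y (.inl hy) Y hY' hA)
    · refine h.gen z ?_ Y hY' hA
      rcases hz with hz | hz | hz
      · exact .inl hz
      · exact absurd hz hzc
      · exact .inr hz

theorem addPoint {D : Tri U} (h : Good A0 R D) {x y c : U} (hx : x ∈ D.2.1) (hy : y ∈ D.2.1)
    (hxy : x ≠ y) (hno : ∀ z, (z, x) ∈ D.2.2 → (z, y) ∈ D.2.2 → False)
    (hc1 : c ∉ D.1) (hc2 : c ∉ D.2.1) :
    Good A0 R (insert c D.1, D.2.1, insert (c, x) (insert (c, y) D.2.2)) := by
  have hcI : ∀ z, (c, z) ∉ D.2.2 := fun z hz => hc1 (h.sub _ _ hz).1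
  refine ⟨?_, ?_, ?_, ?_, ?_, ?_⟩
  · rintro z (rfl | hz') hz
    · exact hc2 hz
    · exact h.disj z hz' hz
  · intro p q hpq
    simp only [Set.mem_insert_iff, Prod.mk.injEq] at hpq ⊢
    rcases hpq with ⟨rfl, rfl⟩ | ⟨rfl, rfl⟩ | hpq
    · exact ⟨.inl rfl, hx⟩
    · exact ⟨.inl rfl, hy⟩
    · exact ⟨.inr (h.sub _ _ hpq).1, (h.sub _ _ hpq).2⟩
  · intro p q a b h1 h2 h3 h4
    simp only [Set.mem_insert_iff, Prod.mk.injEq] at h1 h2 h3 h4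
    have := h.noK p q a b
    have := hno p
    have := hno q
    grind
  · intro a ha b hb hab
    simp only [Set.mem_insert_iff, Prod.mk.injEq] at hab
    rcases hab with ⟨rfl, rfl⟩ | ⟨rfl, rfl⟩ | hab
    · exact absurd (h.base _ ha) (by tauto)
    · exact absurd (h.base _ ha) (by tauto)
    · exact h.ind a ha b hb hab
  · intro a ha
    exact (h.base a ha).imp .inr id
  · intro z hz Y hY hA
    have hY' : Cl D.2.2 Y := hY.anti (fun p hp => .inr (.inr hp))
    by_cases hzc : z = c
    · subst hzc
      exact hY.2 z x y hxy (.inl rfl) (.inr (.inl rfl)) (h.gen x (.inr hx) Y hY' hA)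
        (h.gen y (.inr hy) Y hY' hA)
    · refine h.gen z ?_ Y hY' hA
      rcases hz with (hz | hz) | hz
      · exact absurd hz hzc
      · exact .inl hz
      · exact .inr hz

theorem chain (c : Set (Tri U)) (hc : ∀ D ∈ c, Good A0 R D) (hch : IsChain (· ≤ ·) c)
    (D0 : Tri U) (hD0 : D0 ∈ c) : ∃ E, Good A0 R E ∧ ∀ D ∈ c, D ≤ E := by
  have dir : ∀ D ∈ c, ∀ D' ∈ c, ∃ E ∈ c, D ≤ E ∧ D' ≤ E := hch.directedOn
  refine ⟨({z | ∃ D ∈ c, z ∈ D.1}, {z | ∃ D ∈ c, z ∈ D.2.1}, {z | ∃ D ∈ c, z ∈ D.2.2}),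
    ⟨?_, ?_, ?_, ?_, ?_, ?_⟩, ?_⟩
  · rintro z ⟨D, hD, hz⟩ ⟨D', hD', hz'⟩
    obtain ⟨E, hE, h1, h2⟩ := dir D hD D' hD'
    exact (hc E hE).disj z (h1.1 hz) (h2.2.1 hz')
  · rintro x y ⟨D, hD, h⟩
    exact ⟨⟨D, hD, ((hc D hD).sub x y h).1⟩, ⟨D, hD, ((hc D hD).sub x y h).2⟩⟩
  · rintro x y a b ⟨D1, hD1, h1⟩ ⟨D2, hD2, h2⟩ ⟨D3, hD3, h3⟩ ⟨D4, hD4, h4⟩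
    obtain ⟨E, hE, i1, i2⟩ := dir D1 hD1 D2 hD2
    obtain ⟨F, hF, i3, i4⟩ := dir D3 hD3 D4 hD4
    obtain ⟨G, hG, i5, i6⟩ := dir E hE F hF
    exact (hc G hG).noK x y a b ((i1.trans i5).2.2 h1) ((i2.trans i5).2.2 h2)
      ((i3.trans i6).2.2 h3) ((i4.trans i6).2.2 h4)
  · rintro a ha b hb ⟨D, hD, h⟩
    exact (hc D hD).ind a ha b hb h
  · intro a ha
    exact ((hc D0 hD0).base a ha).imp (fun h => ⟨D0, hD0, h⟩) (fun h => ⟨D0, hD0, h⟩)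
  · rintro z hz Y hY hA
    obtain ⟨D, hD, hz⟩ : ∃ D ∈ c, z ∈ D.1 ∨ z ∈ D.2.1 := by
      rcases hz with ⟨D, hD, hz⟩ | ⟨D, hD, hz⟩
      · exact ⟨D, hD, .inl hz⟩
      · exact ⟨D, hD, .inr hz⟩
    exact (hc D hD).gen z hz Y (hY.anti fun p hp => ⟨D, hD, hp⟩) hA
  · intro D hD
    exact ⟨fun z hz => ⟨D, hD, hz⟩, fun z hz => ⟨D, hD, hz⟩, fun z hz => ⟨D, hD, hz⟩⟩

theorem exists_plane [Uncountable U] {D0 : Tri U} (h0 : Good A0 R D0) (hA : A0.Countable) :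
    ∃ D, D0 ≤ D ∧ Good A0 R D ∧
      (∀ x ∈ D.1, ∀ y ∈ D.1, x ≠ y → ∃ z, (x, z) ∈ D.2.2 ∧ (y, z) ∈ D.2.2) ∧
      (∀ x ∈ D.2.1, ∀ y ∈ D.2.1, x ≠ y → ∃ z, (z, x) ∈ D.2.2 ∧ (z, y) ∈ D.2.2) := by
  obtain ⟨D, hle, hmax⟩ := zorn_le_nonempty₀ {D : Tri U | Good A0 R D}
    (fun c hc hch D hD => chain c hc hch D hD) D0 h0
  have hG : Good A0 R D := hmax.1
  obtain ⟨c, hc⟩ : ∃ c, c ∉ {z | z ∈ D.1 ∨ z ∈ D.2.1} := by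
    by_contra hc
    push Not at hc
    refine Set.not_countable_univ (α := U) ((hG.countable hA).mono fun z _ => hc z)
  simp only [Set.mem_ofPred_eq, not_or] at hc
  refine ⟨D, hle, hG, ?_, ?_⟩
  · intro x hx y hy hxy
    by_contra hn
    push Not at hn
    have h1 := hG.addLine hx hy hxy hn hc.1 hc.2
    have h2 := hmax.2 h1 ⟨le_rfl, Set.subset_insert _ _,
      (Set.subset_insert _ _).trans (Set.subset_insert _ _)⟩
    exact hc.2 (h2.2.1 (Set.mem_insert _ _))
  · intro x hx y hy hxy
    by_contra hn
    push Not at hn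
    have h1 := hG.addPoint hx hy hxy hn hc.1 hc.2
    have h2 := hmax.2 h1 ⟨Set.subset_insert _ _, le_rfl,
      (Set.subset_insert _ _).trans (Set.subset_insert _ _)⟩
    exact hc.1 (h2.1 (Set.mem_insert _ _))

end Good

/-- If `A` is a finite partial plane whose free completion `F(A)` is infinite, then
there is a projective plane `B` such that `A` embeds in `B` as an induced substructure
and generates `B` under `I`-closure, but there is no isomorphism from `B` to `F(A)`
fixing `A` pointwise. -/
theorem statement_11 {A FA : Type u} (SA : IncidenceData A) (hAfin : Finite A)
    (hApp : KFree 2 2 SA) (SFA : IncidenceData FA) (e : IncEmbedding SA SFA)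
    (hFA : IsFreeCompletion 2 2 SA SFA e) (hInf : Infinite FA) :
    ∃ (B : Type u) (SB : IncidenceData B) (f : IncEmbedding SA SB),
      IsProjPlane SB ∧
      iclD 2 2 SB (Set.range f.toFun) = Set.univ ∧
      ¬∃ g : IncIso SB SFA, ∀ a, g.toEquiv (f.toFun a) = e.toFun a := by
  obtain ⟨X, hX0, hX⟩ := fc_of SA SFA e hFA
  have hKA : NoK SA := (kfree_iff SA).1 hApp
  have hK : NoK SFA := by
    apply hX.noK
    rw [hX0]
    rintro _ ⟨x, rfl⟩ _ ⟨y, rfl⟩ _ ⟨a, rfl⟩ _ ⟨b, rfl⟩ h1 h2 h3 h4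
    rw [e.inc_iff] at h1 h2 h3 h4
    exact (hKA x y a b h1 h2 h3 h4).imp (congrArg _) (congrArg _)
  have h0f : (X 0).Finite := hX0 ▸ Set.finite_range _
  obtain ⟨k, n, hn, hd⟩ := hX.three_lines hK h0f
  -- the ambient type and the starting configuration
  let U := FA ⊕ Set FA
  have : Uncountable (Set FA) := by
    rw [← Cardinal.aleph0_lt_mk_iff, Cardinal.mk_set]
    exact lt_of_le_of_lt (Cardinal.aleph0_le_mk FA) (Cardinal.cantor _)
  have : Uncountable U := Function.Injective.uncountable (f := (Sum.inr : Set FA → U)) Sum.inr_injective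
  let c : U := Sum.inr ∅
  let A0 : Set U := Set.range fun a => (Sum.inl (e.toFun a) : U)
  let R : U → U → Prop := fun x y => ∃ a b, x = .inl a ∧ y = .inl b ∧ SFA.inc a b
  let D0 : Tri U := ({z | z = c ∨ ∃ x ∈ X k, SFA.pt x ∧ z = .inl x},
    {z | ∃ x ∈ X k, SFA.ln x ∧ z = .inl x},
    {z | (∃ x ∈ X k, ∃ y ∈ X k, SFA.inc x y ∧ z = (.inl x, .inl y)) ∨ ∃ i, z = (c, .inl (n i))})
  have hI : ∀ x y : FA, ((.inl x, .inl y) : U × U) ∈ D0.2.2 ↔ x ∈ X k ∧ y ∈ X k ∧ SFA.inc x y := by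
    intro x y
    constructor
    · rintro (⟨a, ha, b, hb, hab, h⟩ | ⟨i, h⟩)
      · have e1 : x = a := Sum.inl.inj (Prod.mk.inj h).1
        have e2 : y = b := Sum.inl.inj (Prod.mk.inj h).2
        rw [e1, e2]
        exact ⟨ha, hb, hab⟩
      · simp [c] at h
    · rintro ⟨h1, h2, h3⟩
      exact .inl ⟨x, h1, y, h2, h3, rfl⟩
  have hIc : ∀ z, (c, z) ∈ D0.2.2 ↔ ∃ i, z = .inl (n i) := by
    intro z
    constructor
    · rintro (⟨a, ha, b, hb, hab, h⟩ | ⟨i, h⟩)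
      · simp [c] at h
      · exact ⟨i, (Prod.mk.inj h).2⟩
    · rintro ⟨i, rfl⟩
      exact .inr ⟨i, rfl⟩
  have hIsub : ∀ x y, (x, y) ∈ D0.2.2 → (x = c ∨ ∃ a, x = .inl a) ∧ ∃ b, y = .inl b := by
    rintro x y (⟨a, ha, b, hb, hab, h⟩ | ⟨i, h⟩)
    · simp only [Prod.mk.injEq] at h
      exact ⟨.inr ⟨a, h.1⟩, b, h.2⟩
    · simp only [Prod.mk.injEq] at h
      exact ⟨.inl h.1, _, h.2⟩
  have hgood : Good A0 R D0 := by
    refine ⟨?_, ?_, ?_, ?_, ?_, ?_⟩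
    · rintro z (rfl | ⟨x, hx, px, rfl⟩) ⟨y, hy, ly, h⟩
      · simp [c] at h
      · rw [Sum.inl.injEq] at h
        subst h
        exact SFA.not_pt_and_ln x ⟨px, ly⟩
    · rintro x y (⟨a, ha, b, hb, hab, h⟩ | ⟨i, h⟩)
      · simp only [Prod.mk.injEq] at h
        obtain ⟨rfl, rfl⟩ := h
        exact ⟨.inr ⟨a, ha, (SFA.inc_pt_ln _ _ hab).1, rfl⟩, ⟨b, hb, (SFA.inc_pt_ln _ _ hab).2, rfl⟩⟩
      · simp only [Prod.mk.injEq] at h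
        obtain ⟨rfl, rfl⟩ := h
        exact ⟨.inl rfl, ⟨n i, (hn i).1, (hn i).2, rfl⟩⟩
    · have mix : ∀ (y a b : U), (c, a) ∈ D0.2.2 → (c, b) ∈ D0.2.2 → (∃ v, y = .inl v) →
          (y, a) ∈ D0.2.2 → (y, b) ∈ D0.2.2 → a = b := by
        rintro y a b h1 h2 ⟨v, rfl⟩ h3 h4
        obtain ⟨i, rfl⟩ := (hIc a).1 h1
        obtain ⟨j, rfl⟩ := (hIc b).1 h2
        by_cases hij : i = j
        · rw [hij]
        · rw [hI] at h3 h4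
          exact ((hd i j hij).2 v h3.1 h3.2.2 h4.2.2).elim
      intro x y a b h1 h2 h3 h4
      obtain ⟨hx, a, rfl⟩ := hIsub _ _ h1
      obtain ⟨hy, b, rfl⟩ := hIsub _ _ h4
      rcases hx with rfl | hx
      · rcases hy with rfl | hy
        · exact .inl rfl
        · exact .inr (mix _ _ _ h1 h3 hy h2 h4)
      · rcases hy with rfl | hy
        · exact .inr (mix _ _ _ h2 h4 hx h1 h3)
        · obtain ⟨v, rfl⟩ := hx
          obtain ⟨w, rfl⟩ := hy
          rw [hI] at h1 h2 h3 h4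
          exact (hK v w a b h1.2.2 h2.2.2 h3.2.2 h4.2.2).imp (congrArg _) (congrArg _)
    · rintro _ ⟨a, rfl⟩ _ ⟨b, rfl⟩ hab
      exact ⟨_, _, rfl, rfl, ((hI _ _).1 hab).2.2⟩
    · rintro _ ⟨a, rfl⟩
      have hak : e.toFun a ∈ X k := hX.mono_le (Nat.zero_le k) (hX0 ▸ ⟨a, rfl⟩)
      rcases SFA.pt_or_ln (e.toFun a) with h | h
      · exact .inl (.inr ⟨_, hak, h, rfl⟩)
      · exact .inr ⟨_, hak, h, rfl⟩
    · intro z hz Y hY hA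
      have key : ∀ j, j ≤ k → ∀ x ∈ X j, (.inl x : U) ∈ Y := by
        intro j
        induction j with
        | zero =>
          intro _ x hx
          rw [hX0] at hx
          obtain ⟨a, rfl⟩ := hx
          exact hA ⟨a, rfl⟩
        | succ j ih =>
          intro hj x hx
          by_cases hxj : x ∈ X j
          · exact ih (by omega) x hxj
          have hup : ∀ y ∈ X j, y ∈ X k := fun y hy => hX.mono_le (by omega) hy
          have hxk : x ∈ X k := hX.mono_le hj hx
          rcases SFA.pt_or_ln x with h | h
          · obtain ⟨p, q, hp, hq, hpq, h1, h2, -⟩ := hX.newP j x hx hxj h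
            exact hY.2 _ (.inl p) (.inl q) (fun h' => hpq (Sum.inl.inj h')) ((hI _ _).2 ⟨hxk, hup p hp, h1⟩)
              ((hI _ _).2 ⟨hxk, hup q hq, h2⟩) (ih (by omega) p hp) (ih (by omega) q hq)
          · obtain ⟨p, q, hp, hq, hpq, h1, h2, -⟩ := hX.newL j x hx hxj h
            exact hY.1 (.inl p) (.inl q) _ (fun h' => hpq (Sum.inl.inj h')) ((hI _ _).2 ⟨hup p hp, hxk, h1⟩)
              ((hI _ _).2 ⟨hup q hq, hxk, h2⟩) (ih (by omega) p hp) (ih (by omega) q hq)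
      rcases hz with (rfl | ⟨x, hx, -, rfl⟩) | ⟨x, hx, -, rfl⟩
      · have h01 := (hd 0 1 (by decide)).1
        exact hY.2 c (.inl (n 0)) (.inl (n 1)) (fun h' => h01 (Sum.inl.inj h'))
          ((hIc _).2 ⟨0, rfl⟩) ((hIc _).2 ⟨1, rfl⟩) (key k le_rfl _ (hn 0).1) (key k le_rfl _ (hn 1).1)
      · exact key k le_rfl x hx
      · exact key k le_rfl x hx
  obtain ⟨D, hle, hG, hJ, hM⟩ := hgood.exists_plane (Set.countable_range _)
  have hXP : ∀ x ∈ X k, SFA.pt x → (.inl x : U) ∈ D.1 := fun x hx px => hle.1 (.inr ⟨x, hx, px, rfl⟩)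
  have hXL : ∀ x ∈ X k, SFA.ln x → (.inl x : U) ∈ D.2.1 := fun x hx px => hle.2.1 ⟨x, hx, px, rfl⟩
  have hXc : ∀ x ∈ X k, (.inl x : U) ∈ D.1 ∨ (.inl x : U) ∈ D.2.1 := fun x hx =>
    (SFA.pt_or_ln x).imp (hXP x hx) (hXL x hx)
  have hak : ∀ a, e.toFun a ∈ X k := fun a => hX.mono_le (Nat.zero_le k) (hX0 ▸ ⟨a, rfl⟩)
  let B := {z : U // z ∈ D.1 ∨ z ∈ D.2.1}
  let SB : IncidenceData B :=
    { pt := fun z => z.1 ∈ D.1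
      ln := fun z => z.1 ∈ D.2.1
      inc := fun x y => (x.1, y.1) ∈ D.2.2
      pt_or_ln := fun z => z.2
      not_pt_and_ln := fun z h => hG.disj _ h.1 h.2
      inc_pt_ln := fun x y h => hG.sub _ _ h }
  have hptX : ∀ x (hx : x ∈ X k), (.inl x : U) ∈ D.1 ↔ SFA.pt x := by
    intro x hx
    refine ⟨fun h => ?_, hXP x hx⟩
    exact (SFA.pt_or_ln x).resolve_right fun hl => hG.disj _ h (hXL x hx hl)
  have hlnX : ∀ x (hx : x ∈ X k), (.inl x : U) ∈ D.2.1 ↔ SFA.ln x := by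
    intro x hx
    refine ⟨fun h => ?_, hXL x hx⟩
    exact (SFA.pt_or_ln x).resolve_left fun hl => hG.disj _ (hXP x hx hl) h
  let f : IncEmbedding SA SB :=
    { toFun := fun a => ⟨.inl (e.toFun a), hXc _ (hak a)⟩
      inj := fun a b h => e.inj (Sum.inl.inj (congrArg Subtype.val h))
      pt_iff := fun a => (hptX _ (hak a)).trans (e.pt_iff a)
      ln_iff := fun a => (hlnX _ (hak a)).trans (e.ln_iff a)
      inc_iff := fun a b => by
        rw [← e.inc_iff]
        constructor
        · intro h
          obtain ⟨x, y, hx, hy, hxy⟩ := hG.ind _ ⟨a, rfl⟩ _ ⟨b, rfl⟩ h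
          rw [Sum.inl.inj hx, Sum.inl.inj hy]
          exact hxy
        · intro h
          exact hle.2.2 ((hI _ _).2 ⟨hak a, hak b, h⟩) }
  have hKB : NoK SB := fun x y a b h1 h2 h3 h4 =>
    (hG.noK _ _ _ _ h1 h2 h3 h4).imp Subtype.ext Subtype.ext
  refine ⟨B, SB, f, ⟨(kfree_iff SB).2 hKB, ?_, ?_⟩, ?_, ?_⟩
  · intro x y px py hxy
    obtain ⟨z, h1, h2⟩ := hJ _ px _ py (fun h => hxy (Subtype.ext h))
    refine ⟨⟨z, .inr (hG.sub _ _ h1).2⟩, ⟨h1, h2⟩, ?_⟩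
    rintro w ⟨h3, h4⟩
    exact (hKB x y w ⟨z, .inr (hG.sub _ _ h1).2⟩ h3 h4 h1 h2).resolve_left hxy
  · intro x y px py hxy
    obtain ⟨z, h1, h2⟩ := hM _ px _ py (fun h => hxy (Subtype.ext h))
    refine ⟨⟨z, .inl (hG.sub _ _ h1).1⟩, ⟨h1, h2⟩, ?_⟩
    rintro w ⟨h3, h4⟩
    exact (hKB w ⟨z, .inl (hG.sub _ _ h1).1⟩ x y h3 h1 h4 h2).resolve_right hxy
  · rw [Set.eq_univ_iff_forall]
    intro z
    rw [iclD, Set.mem_sInter]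
    rintro Y ⟨⟨hY1, hY2⟩, hA⟩
    have h := hG.gen z.1 z.2 (Subtype.val '' Y) ⟨?_, ?_⟩ ?_
    · obtain ⟨w, hw, hwz⟩ := h
      rwa [← Subtype.ext hwz]
    · rintro _ _ a hxy h1 h2 ⟨x, hx, rfl⟩ ⟨y, hy, rfl⟩
      refine ⟨⟨a, .inr (hG.sub _ _ h1).2⟩, hY1 ![x, y] _ ?_ ?_ ?_ ?_, rfl⟩
      · have hxy' : x ≠ y := fun h => hxy (congrArg _ h)
        intro i j hij
        fin_cases i <;> fin_cases j <;> simp_all [eq_comm]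
      · intro i
        fin_cases i
        · exact (hG.sub _ _ h1).1
        · exact (hG.sub _ _ h2).1
      · intro i
        fin_cases i <;> assumption
      · intro i
        fin_cases i <;> assumption
    · rintro a _ _ hxy h1 h2 ⟨x, hx, rfl⟩ ⟨y, hy, rfl⟩
      refine ⟨⟨a, .inl (hG.sub _ _ h1).1⟩, hY2 ![x, y] _ ?_ ?_ ?_ ?_, rfl⟩
      · have hxy' : x ≠ y := fun h => hxy (congrArg _ h)
        intro i j hij
        fin_cases i <;> fin_cases j <;> simp_all [eq_comm]
      · intro i
        fin_cases i
        · exact (hG.sub _ _ h1).2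
        · exact (hG.sub _ _ h2).2
      · intro i
        fin_cases i <;> assumption
      · intro i
        fin_cases i <;> assumption
    · rintro _ ⟨a, rfl⟩
      exact ⟨f.toFun a, hA ⟨a, rfl⟩, rfl⟩
  · rintro ⟨g, hg⟩
    have key : ∀ j, j ≤ k → ∀ x ∈ X j, ∀ hx : (.inl x : U) ∈ D.1 ∨ (.inl x : U) ∈ D.2.1,
        g.toEquiv ⟨.inl x, hx⟩ = x := by
      intro j
      induction j with
      | zero =>
        intro _ x hx hx'
        rw [hX0] at hx
        obtain ⟨a, rfl⟩ := hx
        exact hg a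
      | succ j ih =>
        intro hj x hx hx'
        by_cases hxj : x ∈ X j
        · exact ih (by omega) x hxj _
        have hup : ∀ y ∈ X j, y ∈ X k := fun y hy => hX.mono_le (by omega) hy
        have hxk : x ∈ X k := hX.mono_le hj hx
        rcases SFA.pt_or_ln x with h | h
        · obtain ⟨p, q, hp, hq, hpq, h1, h2, -⟩ := hX.newP j x hx hxj h
          have e1 : SB.inc ⟨.inl x, hx'⟩ ⟨.inl p, hXc p (hup p hp)⟩ :=
            hle.2.2 ((hI _ _).2 ⟨hxk, hup p hp, h1⟩)
          have e2 : SB.inc ⟨.inl x, hx'⟩ ⟨.inl q, hXc q (hup q hq)⟩ :=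
            hle.2.2 ((hI _ _).2 ⟨hxk, hup q hq, h2⟩)
          rw [← g.inc_iff, ih (by omega) p hp] at e1
          rw [← g.inc_iff, ih (by omega) q hq] at e2
          exact (hK _ _ _ _ e1 h1 e2 h2).resolve_right hpq
        · obtain ⟨p, q, hp, hq, hpq, h1, h2, -⟩ := hX.newL j x hx hxj h
          have e1 : SB.inc ⟨.inl p, hXc p (hup p hp)⟩ ⟨.inl x, hx'⟩ :=
            hle.2.2 ((hI _ _).2 ⟨hup p hp, hxk, h1⟩)
          have e2 : SB.inc ⟨.inl q, hXc q (hup q hq)⟩ ⟨.inl x, hx'⟩ :=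
            hle.2.2 ((hI _ _).2 ⟨hup q hq, hxk, h2⟩)
          rw [← g.inc_iff, ih (by omega) p hp] at e1
          rw [← g.inc_iff, ih (by omega) q hq] at e2
          exact (hK _ _ _ _ e1 e2 h1 h2).resolve_left hpq
    refine hX.not_conc hn hd (g.toEquiv ⟨c, .inl (hle.1 (.inl rfl))⟩) fun i => ?_
    have e1 : SB.inc ⟨c, .inl (hle.1 (.inl rfl))⟩ ⟨.inl (n i), hXc _ (hn i).1⟩ :=
      hle.2.2 ((hIc _).2 ⟨i, rfl⟩)
    rwa [← g.inc_iff, key k le_rfl _ (hn i).1] at e1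
end

section
/- Let m, n ≥ 1. If every finite K_{m,n}-free incidence structure embeds as an induced substructure into a finite member of T^c_{m,n}, then there exists an existentially closed K_{m,n}-free incidence structure M such that for every existentially closed K_{m,n}-free incidence structure N there is an elementary embedding of M into N (i.e., the common theory of existentially closed K_{m,n}-free incidence structures has a prime model). -/
open FirstOrder FirstOrder.Language

universe u v

/-- Relation symbols of the language of incidence structures: two unary symbols
(`pt` for "point", `lin` for "line") and one binary symbol (`inc` for "incidence"). -/
inductive IncRel : ℕ → Type
  | pt : IncRel 1
  | lin : IncRel 1
  | inc : IncRel 2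

/-- The first-order language `{P, L, I}` of incidence structures. -/
def IncLang : FirstOrder.Language := ⟨fun _ => Empty, IncRel⟩

section
variable {M : Type u} [IncLang.Structure M]

/-- `x` is a point. -/
def ptL (x : M) : Prop := Structure.RelMap (L := IncLang) IncRel.pt ![x]

/-- `x` is a line. -/
def lnL (x : M) : Prop := Structure.RelMap (L := IncLang) IncRel.lin ![x]

/-- `x` is incident to `y`. -/
def incL (x y : M) : Prop := Structure.RelMap (L := IncLang) IncRel.inc ![x, y]

end

/-- `M` is an incidence structure: points and lines partition the domain, and
incidence only holds between a point and a line. -/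
def IsIncidenceL (M : Type u) [IncLang.Structure M] : Prop :=
  (∀ x : M, ptL x ∨ lnL x) ∧ (∀ x : M, ¬(ptL x ∧ lnL x)) ∧
    ∀ x y : M, incL x y → ptL x ∧ lnL y

/-- `M` is `K_{m,n}`-free: there are no `m` pairwise distinct points and `n` pairwise
distinct lines with every one of the points incident to every one of the lines. -/
def KFreeL (m n : ℕ) (M : Type u) [IncLang.Structure M] : Prop :=
  ¬∃ (a : Fin m → M) (b : Fin n → M),
      Function.Injective a ∧ Function.Injective b ∧
      (∀ i, ptL (a i)) ∧ (∀ j, lnL (b j)) ∧ ∀ i j, incL (a i) (b j)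

/-- `M` is an existentially closed `K_{m,n}`-free incidence structure: `M` is a
`K_{m,n}`-free incidence structure, and for every `K_{m,n}`-free incidence structure
`N` containing `M` as an induced substructure (i.e. admitting an embedding of `M`),
every existential formula `∃ ȳ φ(ā, ȳ)` (with `φ` quantifier-free and parameters `ā`
from `M`) that holds in `N` also holds in `M`. -/
def IsECL (m n : ℕ) (M : Type u) [IncLang.Structure M] : Prop :=
  IsIncidenceL M ∧ KFreeL m n M ∧
    ∀ (N : Type u) [IncLang.Structure N], IsIncidenceL N → KFreeL m n N →
      ∀ (f : M ↪[IncLang] N) (k : ℕ) (φ : IncLang.BoundedFormula M k), φ.IsQF →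
        (∃ xs : Fin k → N, φ.Realize (f : M → N) xs) →
          ∃ xs : Fin k → M, φ.Realize (id : M → M) xs

/-- Membership in `T^c_{m,n}`: a `K_{m,n}`-free incidence structure in which every `m`
pairwise distinct points are simultaneously incident to exactly `n-1` lines and every
`n` pairwise distinct lines are simultaneously incident to exactly `m-1` points. -/
def TcL (m n : ℕ) (M : Type u) [IncLang.Structure M] : Prop :=
  IsIncidenceL M ∧ KFreeL m n M ∧
  (∀ a : Fin m → M, Function.Injective a → (∀ i, ptL (a i)) →
    ∃ b : Fin (n - 1) → M, Function.Injective b ∧ (∀ j, lnL (b j)) ∧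
      (∀ i j, incL (a i) (b j)) ∧
      ∀ y : M, lnL y → (∀ i, incL (a i) y) → ∃ j, y = b j) ∧
  (∀ b : Fin n → M, Function.Injective b → (∀ j, lnL (b j)) →
    ∃ a : Fin (m - 1) → M, Function.Injective a ∧ (∀ i, ptL (a i)) ∧
      (∀ i j, incL (a i) (b j)) ∧
      ∀ x : M, ptL x → (∀ j, incL x (b j)) → ∃ i, x = a i)


/-- Abstract incidence structure. -/
structure Inc (X : Type*) where
  pt : X → Prop
  inc : X → X → Prop
  inc_pt : ∀ {x y}, inc x y → pt x
  inc_ln : ∀ {x y}, inc x y → ¬ pt y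

namespace Inc

def swap {X : Type*} (S : Inc X) : Inc X where
  pt x := ¬ S.pt x
  inc x y := S.inc y x
  inc_pt h := S.inc_ln h
  inc_ln h := not_not.2 (S.inc_pt h)

def comap {X Y : Type*} (S : Inc X) (f : Y → X) : Inc Y where
  pt x := S.pt (f x)
  inc x y := S.inc (f x) (f y)
  inc_pt h := S.inc_pt h
  inc_ln h := S.inc_ln h

structure IsE {X Y : Type*} (S : Inc X) (T : Inc Y) (f : X → Y) : Prop where
  inj : Function.Injective f
  pt : ∀ x, T.pt (f x) ↔ S.pt x
  inc : ∀ x y, T.inc (f x) (f y) ↔ S.inc x y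

def KF {X : Type*} (S : Inc X) (m n : ℕ) : Prop :=
  ∀ A B : Finset X, (∀ a ∈ A, ∀ b ∈ B, S.inc a b) → A.card < m ∨ B.card < n

def HStep {X : Type*} (S : Inc X) (m n : ℕ) (A A' : Set X) : Prop :=
  ∀ F : Finset X, ↑F ⊆ A → (∀ a ∈ F, S.pt a) → F.card = m →
    ∃ G : Finset X, ↑G ⊆ A' ∧ G.card = n - 1 ∧ ∀ a ∈ F, ∀ b ∈ G, S.inc a b

def Step {X : Type*} (S : Inc X) (m n : ℕ) (A A' : Set X) : Prop :=
  HStep S m n A A' ∧ HStep S.swap n m A A'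

def Tc {X : Type*} (S : Inc X) (m n : ℕ) : Prop :=
  KF S m n ∧ Step S m n Set.univ Set.univ

def HCl {X : Type*} (S : Inc X) (m : ℕ) (A : Set X) : Prop :=
  ∀ d, d ∉ A → ∀ F : Finset X, ↑F ⊆ A → (∀ a ∈ F, S.inc a d) → F.card < m

def Cl {X : Type*} (S : Inc X) (m n : ℕ) (A : Set X) : Prop :=
  HCl S m A ∧ HCl S.swap n A

/-- finitary form of existential closedness -/
def EC {M : Type u} (S : Inc M) (m n : ℕ) : Prop :=
  KF S m n ∧ ∀ (N : Type u) (T : Inc N), KF T m n → ∀ f : M → N, IsE S T f →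
    ∀ (F : Set M) (B : Set N), F.Finite → B.Finite →
      ∃ h : B → M, IsE (T.comap (Subtype.val : B → N)) S h ∧
        ∀ a ∈ F, ∀ hb : f a ∈ B, h ⟨f a, hb⟩ = a

theorem swap_swap {X : Type*} (S : Inc X) : S.swap.swap = S := by
  cases S; simp [swap]

theorem IsE.swap {X Y : Type*} {S : Inc X} {T : Inc Y} {f : X → Y} (h : IsE S T f) :
    IsE S.swap T.swap f :=
  ⟨h.inj, fun x => not_congr (h.pt x), fun x y => h.inc y x⟩

theorem IsE.comp {X Y Z : Type*} {S : Inc X} {T : Inc Y} {U : Inc Z} {f : X → Y} {g : Y → Z}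
    (hg : IsE T U g) (hf : IsE S T f) : IsE S U (g ∘ f) :=
  ⟨hg.inj.comp hf.inj, fun x => (hg.pt _).trans (hf.pt x),
    fun x y => (hg.inc _ _).trans (hf.inc x y)⟩

theorem isE_comap {X Y : Type*} (S : Inc X) {f : Y → X} (hf : Function.Injective f) :
    IsE (S.comap f) S f := ⟨hf, fun _ => Iff.rfl, fun _ _ => Iff.rfl⟩

theorem IsE.of_comp {X Y Z : Type*} {S : Inc X} {T : Inc Y} {U : Inc Z} {f : X → Y} {g : Y → Z}
    (hg : IsE T U g) (hf : IsE S U (g ∘ f)) : IsE S T f :=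
  ⟨hf.inj.of_comp, fun x => (hg.pt _).symm.trans (hf.pt x),
    fun x y => (hg.inc _ _).symm.trans (hf.inc x y)⟩

theorem KF.swap {X : Type*} {S : Inc X} {m n : ℕ} (h : KF S m n) : KF S.swap n m :=
  fun A B hAB => (h B A fun a ha b hb => hAB b hb a ha).symm

theorem KF.of_isE {X Y : Type*} {S : Inc X} {T : Inc Y} {f : X → Y} {m n : ℕ}
    (h : KF T m n) (hf : IsE S T f) : KF S m n := by
  intro A B hAB
  have := h (A.map ⟨f, hf.inj⟩) (B.map ⟨f, hf.inj⟩) (by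
    simp only [Finset.mem_map, Function.Embedding.coeFn_mk]
    rintro _ ⟨a, ha, rfl⟩ _ ⟨b, hb, rfl⟩
    exact (hf.inc _ _).2 (hAB a ha b hb))
  simpa using this

theorem exists_map {X Y : Type*} {f : X → Y} (hf : Function.Injective f) {s : Set X}
    {t : Finset Y} (h : ∀ y ∈ t, ∃ x ∈ s, f x = y) :
    ∃ s' : Finset X, ↑s' ⊆ s ∧ s'.map ⟨f, hf⟩ = t := by
  classical
  obtain ⟨s', h1, h2⟩ := (Finset.subset_set_image_iff (s := s) (t := t) (f := f)).1
    (fun y hy => h y hy)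
  exact ⟨s', h1, by rw [Finset.map_eq_image]; exact h2⟩

theorem HStep.push {X Y : Type*} {S : Inc X} {T : Inc Y} {f : X → Y} {m n : ℕ} {A A' : Set X}
    (h : HStep S m n A A') (hf : IsE S T f) : HStep T m n (f '' A) (f '' A') := by
  intro F hF hp hc
  obtain ⟨F', h1, rfl⟩ := exists_map hf.inj (s := A) (t := F) (fun y hy => hF hy)
  obtain ⟨G, g1, g2, g3⟩ := h F' h1 (fun a ha => (hf.pt a).1 (hp _ (by simpa using ha)))
    (by simpa using hc)
  refine ⟨G.map ⟨f, hf.inj⟩, ?_, by simpa using g2, ?_⟩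
  · simpa using Set.image_mono g1
  · simp only [Finset.mem_map, Function.Embedding.coeFn_mk]
    rintro _ ⟨a, ha, rfl⟩ _ ⟨b, hb, rfl⟩
    exact (hf.inc _ _).2 (g3 a ha b hb)

theorem Step.push {X Y : Type*} {S : Inc X} {T : Inc Y} {f : X → Y} {m n : ℕ} {A A' : Set X}
    (h : Step S m n A A') (hf : IsE S T f) : Step T m n (f '' A) (f '' A') :=
  ⟨h.1.push hf, h.2.push hf.swap⟩

theorem HStep.pull {X Y : Type*} {S : Inc X} {T : Inc Y} {f : X → Y} {m n : ℕ} {A A' : Set Y}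
    (h : HStep T m n A A') (hf : IsE S T f) (hA' : A' ⊆ Set.range f) :
    HStep S m n (f ⁻¹' A) (f ⁻¹' A') := by
  intro F hF hp hc
  obtain ⟨G, g1, g2, g3⟩ := h (F.map ⟨f, hf.inj⟩) (by simpa using hF)
    (by simpa using fun a ha => (hf.pt a).2 (hp a ha)) (by simpa using hc)
  obtain ⟨G', k1, rfl⟩ := exists_map hf.inj (s := f ⁻¹' A') (t := G) (fun y hy => by
    obtain ⟨x, rfl⟩ := hA' (g1 hy)
    exact ⟨x, g1 hy, rfl⟩)
  refine ⟨G', k1, by simpa using g2, fun a ha b hb => (hf.inc _ _).1 (g3 _ ?_ _ ?_)⟩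
  · simpa using ha
  · simpa using hb

theorem Step.pull {X Y : Type*} {S : Inc X} {T : Inc Y} {f : X → Y} {m n : ℕ} {A A' : Set Y}
    (h : Step T m n A A') (hf : IsE S T f) (hA' : A' ⊆ Set.range f) :
    Step S m n (f ⁻¹' A) (f ⁻¹' A') :=
  ⟨h.1.pull hf hA', h.2.pull hf.swap hA'⟩

theorem HStep.lt {X : Type*} {S : Inc X} {m n : ℕ} {A A' : Set X} (hn : 1 ≤ n)
    (hk : KF S m n) (h : HStep S m n A A') {d : X} (hd : d ∉ A') {F : Finset X}
    (hF : ↑F ⊆ A) (hi : ∀ a ∈ F, S.inc a d) : F.card < m := by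
  classical
  by_contra hc
  obtain ⟨F', h1, h2⟩ := Finset.exists_subset_card_eq (not_lt.1 hc)
  obtain ⟨G, g1, g2, g3⟩ := h F' (fun x hx => hF (h1 hx))
    (fun a ha => S.inc_pt (hi a (h1 ha))) h2
  have hdG : d ∉ G := fun h => hd (g1 h)
  have := hk F' (insert d G) (by
    intro a ha b hb
    rcases Finset.mem_insert.1 hb with rfl | hb
    · exact hi a (h1 ha)
    · exact g3 a ha b hb)
  rw [Finset.card_insert_of_notMem hdG] at this
  omega

/-- free amalgam -/
def amalg {N D : Type*} (T : Inc N) (S : Inc D) (A : Set D) (g : A → N)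
    (hg : IsE (S.comap Subtype.val) T g) : Inc (N ⊕ {d // d ∉ A}) where
  pt := Sum.elim T.pt (fun d => S.pt d.1)
  inc x y := match x, y with
    | .inl x, .inl y => T.inc x y
    | .inr x, .inr y => S.inc x.1 y.1
    | .inl x, .inr y => ∃ a : A, g a = x ∧ S.inc a.1 y.1
    | .inr x, .inl y => ∃ a : A, g a = y ∧ S.inc x.1 a.1
  inc_pt {x y} h := by
    rcases x with x | x <;> rcases y with y | y
    · exact T.inc_pt h
    · obtain ⟨a, rfl, ha⟩ := h
      exact (hg.pt a).2 (S.inc_pt ha)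
    · obtain ⟨a, rfl, ha⟩ := h
      exact S.inc_pt ha
    · exact S.inc_pt (y := y.1) h
  inc_ln {x y} h := by
    rcases x with x | x <;> rcases y with y | y
    · exact T.inc_ln h
    · obtain ⟨a, rfl, ha⟩ := h
      exact S.inc_ln ha
    · obtain ⟨a, rfl, ha⟩ := h
      exact fun h => S.inc_ln ha ((hg.pt a).1 h)
    · exact S.inc_ln (x := x.1) h

theorem exists_amalg {N D : Type u} (T : Inc N) (S : Inc D) (A : Set D) (g : A → N)
    (hg : IsE (S.comap Subtype.val) T g) {m n : ℕ} (hT : KF T m n) (hS : KF S m n)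
    (hc : Cl S m n A) :
    ∃ (N' : Type u) (T' : Inc N') (f : N → N') (h : D → N'), KF T' m n ∧ IsE T T' f ∧
      IsE S T' h ∧ (∀ a : A, h a = f (g a)) ∧ ∀ x, x ∈ Set.range f ∨ x ∈ Set.range h := by
  classical
  set T' := amalg T S A g hg with hT'
  set f : N → N ⊕ {d // d ∉ A} := Sum.inl with hf
  set h : D → N ⊕ {d // d ∉ A} := fun d => if hd : d ∈ A then .inl (g ⟨d, hd⟩) else .inr ⟨d, hd⟩
    with hh
  have fE : IsE T T' f := ⟨Sum.inl_injective, fun _ => Iff.rfl, fun _ _ => Iff.rfl⟩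
  have hA : ∀ d (hd : d ∈ A), h d = .inl (g ⟨d, hd⟩) := fun d hd => dif_pos hd
  have hnA : ∀ d (hd : d ∉ A), h d = .inr ⟨d, hd⟩ := fun d hd => dif_neg hd
  have hE : IsE S T' h := by
    refine ⟨?_, ?_, ?_⟩
    · intro x y hxy
      by_cases hx : x ∈ A <;> by_cases hy : y ∈ A
      · rw [hA x hx, hA y hy] at hxy
        exact congrArg Subtype.val (hg.inj (Sum.inl_injective hxy))
      · rw [hA x hx, hnA y hy] at hxy; cases hxy
      · rw [hnA x hx, hA y hy] at hxy; cases hxy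
      · rw [hnA x hx, hnA y hy] at hxy
        exact congrArg Subtype.val (Sum.inr_injective hxy)
    · intro x
      by_cases hx : x ∈ A
      · rw [hA x hx]; exact hg.pt _
      · rw [hnA x hx]; exact Iff.rfl
    · intro x y
      by_cases hx : x ∈ A <;> by_cases hy : y ∈ A
      · rw [hA x hx, hA y hy]; exact hg.inc _ _
      · rw [hA x hx, hnA y hy]
        constructor
        · rintro ⟨a, ha, hi⟩
          rw [hg.inj ha] at hi; exact hi
        · exact fun hi => ⟨_, rfl, hi⟩
      · rw [hnA x hx, hA y hy]
        constructor
        · rintro ⟨a, ha, hi⟩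
          rw [hg.inj ha] at hi; exact hi
        · exact fun hi => ⟨_, rfl, hi⟩
      · rw [hnA x hx, hnA y hy]; exact Iff.rfl
  have key1 : ∀ x y, x ∉ Set.range f → (T'.inc x y ∨ T'.inc y x) → y ∈ Set.range h := by
    rintro (x | x) (y | y) hx hxy
    · exact absurd ⟨x, rfl⟩ hx
    · exact absurd ⟨x, rfl⟩ hx
    · rcases hxy with ⟨a, rfl, -⟩ | ⟨a, rfl, -⟩
      · exact ⟨a, hA a a.2⟩
      · exact ⟨a, hA a a.2⟩
    · exact ⟨y.1, hnA _ y.2⟩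
  have key2 : ∀ x y, x ∉ Set.range h → (T'.inc x y ∨ T'.inc y x) → y ∈ Set.range f := by
    rintro (x | x) (y | y) hx hxy
    · exact ⟨y, rfl⟩
    · rcases hxy with ⟨a, rfl, -⟩ | ⟨a, rfl, -⟩
      · exact absurd ⟨a.1, hA a a.2⟩ hx
      · exact absurd ⟨a.1, hA a a.2⟩ hx
    · exact ⟨y, rfl⟩
    · exact absurd ⟨x.1, hnA _ x.2⟩ hx
  have key3 : ∀ x, x ∈ Set.range f → x ∈ Set.range h → ∃ d ∈ A, h d = x := by
    rintro _ ⟨x, rfl⟩ ⟨d, hd⟩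
    refine ⟨d, ?_, hd⟩
    by_contra hdA
    rw [hnA d hdA] at hd; cases hd
  have key4 : ∀ x, x ∉ Set.range f → ∃ d, d ∉ A ∧ h d = x := by
    rintro (x | x) hx
    · exact absurd ⟨x, rfl⟩ hx
    · exact ⟨x.1, x.2, hnA _ x.2⟩
  refine ⟨_, T', f, h, ?_, fE, hE, fun a => hA a a.2, ?_⟩
  · intro P Q hPQ
    by_cases hP : ∀ p ∈ P, p ∈ Set.range f
    · by_cases hQ : ∀ q ∈ Q, q ∈ Set.range f
      · obtain ⟨P', -, rfl⟩ := exists_map fE.inj (s := Set.univ) (t := P) (by simpa using hP)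
        obtain ⟨Q', -, rfl⟩ := exists_map fE.inj (s := Set.univ) (t := Q) (by simpa using hQ)
        simpa using hT P' Q' fun a ha b hb => (fE.inc _ _).1 (hPQ _ (Finset.mem_map_of_mem _ ha) _ (Finset.mem_map_of_mem _ hb))
      · push Not at hQ
        obtain ⟨q, hq, hqf⟩ := hQ
        obtain ⟨d, hd, rfl⟩ := key4 q hqf
        obtain ⟨P', hP', rfl⟩ := exists_map hE.inj (s := A) (t := P) (fun p hp =>
          key3 p (hP p hp) (key1 _ p hqf (Or.inr (hPQ p hp _ hq))))
        left
        simpa using hc.1 d hd P' hP' fun a ha => (hE.inc _ _).1 (hPQ _ (Finset.mem_map_of_mem _ ha) _ hq)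
    · push Not at hP
      obtain ⟨p, hp, hpf⟩ := hP
      have hQ : ∀ q ∈ Q, q ∈ Set.range h := fun q hq => key1 p q hpf (Or.inl (hPQ p hp q hq))
      by_cases hP' : ∀ p ∈ P, p ∈ Set.range h
      · obtain ⟨P', -, rfl⟩ := exists_map hE.inj (s := Set.univ) (t := P) (by simpa using hP')
        obtain ⟨Q', -, rfl⟩ := exists_map hE.inj (s := Set.univ) (t := Q) (by simpa using hQ)
        simpa using hS P' Q' fun a ha b hb => (hE.inc _ _).1 (hPQ _ (Finset.mem_map_of_mem _ ha) _ (Finset.mem_map_of_mem _ hb))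
      · push Not at hP'
        obtain ⟨p', hp', hpf'⟩ := hP'
        obtain ⟨d, hd, rfl⟩ := key4 p hpf
        obtain ⟨Q', hQ', rfl⟩ := exists_map hE.inj (s := A) (t := Q) (fun q hq =>
          key3 q (key2 _ q hpf' (Or.inl (hPQ p' hp' _ hq))) (hQ q hq))
        right
        simpa using hc.2 d hd Q' hQ' fun a ha => (hE.inc _ _).1 (hPQ _ hp _ (Finset.mem_map_of_mem _ ha))
  · rintro (x | x)
    · exact Or.inl ⟨x, rfl⟩
    · exact Or.inr ⟨x.1, hnA _ x.2⟩

/-- one new line through the points of `A` -/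
def addLine {M : Type*} (T : Inc M) (A : Finset M) (hA : ∀ a ∈ A, T.pt a) : Inc (Option M) where
  pt x := match x with
    | none => False
    | some x => T.pt x
  inc x y := match x, y with
    | some x, some y => T.inc x y
    | some x, none => x ∈ A
    | none, _ => False
  inc_pt {x y} h := by
    rcases x with _ | x <;> rcases y with _ | y
    · exact h
    · exact h
    · exact hA x h
    · exact T.inc_pt h
  inc_ln {x y} h := by
    rcases x with _ | x <;> rcases y with _ | y
    · exact id
    · exact h.elim
    · exact id
    · exact T.inc_ln h

theorem addLine_KF {M : Type*} (T : Inc M) (A : Finset M) (hA : ∀ a ∈ A, T.pt a) {m n : ℕ}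
    (hn : 1 ≤ n) (hk : KF T m n) (hAm : A.card = m)
    (hB : ∀ B : Finset M, (∀ a ∈ A, ∀ b ∈ B, T.inc a b) → B.card < n - 1) :
    KF (T.addLine A hA) m n := by
  classical
  intro P Q hPQ
  rcases Q.eq_empty_or_nonempty with rfl | ⟨q, hq⟩
  · right; simp only [Finset.card_empty]; omega
  have hP : ∀ p ∈ P, ∃ x ∈ Set.univ, some x = p := by
    rintro (_ | x) hx
    · exact (hPQ _ hx _ hq).elim
    · exact ⟨x, trivial, rfl⟩
  obtain ⟨P', -, rfl⟩ := exists_map (Option.some_injective M) hP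
  obtain ⟨Q', -, hQ'⟩ := exists_map (Option.some_injective M) (s := Set.univ)
    (t := Q.erase none) (by
      rintro (_ | x) hx
      · simp at hx
      · exact ⟨x, trivial, rfl⟩)
  have hcard : Q'.card = (Q.erase none).card := by rw [← hQ']; simp
  have hin : ∀ p ∈ P', ∀ q ∈ Q', T.inc p q := fun p hp q hq =>
    hPQ (some p) (Finset.mem_map_of_mem _ hp) (some q)
      (Finset.mem_of_mem_erase (hQ' ▸ Finset.mem_map_of_mem _ hq))
  by_cases hnQ : none ∈ Q
  · rw [Finset.card_erase_of_mem hnQ] at hcard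
    by_cases hlt : P'.card < m
    · left; simpa using hlt
    have hsub : P' ⊆ A := fun p hp => hPQ (some p) (Finset.mem_map_of_mem _ hp) none hnQ
    have heq : P' = A := Finset.eq_of_subset_of_card_le hsub (by omega)
    have := hB Q' (heq ▸ hin)
    right; omega
  · rw [Finset.erase_eq_of_notMem hnQ] at hcard
    simpa [← hcard] using hk P' Q' hin

theorem EC.swap {M : Type u} {S : Inc M} {m n : ℕ} (h : EC S m n) : EC S.swap n m := by
  refine ⟨h.1.swap, fun N T hT f hf F B hF hB => ?_⟩
  obtain ⟨g, g1, g2⟩ := h.2 N T.swap hT.swap f (by simpa [swap_swap] using hf.swap) F B hF hB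
  refine ⟨g, ?_, g2⟩
  have := g1.swap
  have e : (T.swap.comap (Subtype.val : B → N)).swap = T.comap Subtype.val := by
    cases T; simp [Inc.swap, comap]
  rwa [e] at this

theorem EC.hstep {M : Type u} {S : Inc M} {m n : ℕ} (hn : 1 ≤ n) (h : EC S m n) :
    HStep S m n Set.univ Set.univ := by
  classical
  intro A _ hA hAm
  have : ∀ j, j ≤ n - 1 → ∃ G : Finset M, G.card = j ∧ ∀ a ∈ A, ∀ b ∈ G, S.inc a b := by
    intro j
    induction j with
    | zero => exact fun _ => ⟨∅, by simp⟩
    | succ j ih =>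
      intro hj
      obtain ⟨G, g1, g2⟩ := ih (by omega)
      by_contra hno
      have hB : ∀ B : Finset M, (∀ a ∈ A, ∀ b ∈ B, S.inc a b) → B.card < n - 1 := by
        intro B hB
        by_contra hc
        obtain ⟨B', b1, b2⟩ := Finset.exists_subset_card_eq (s := B) (n := j + 1) (by omega)
        exact hno ⟨B', b2, fun a ha b hb => hB a ha b (b1 hb)⟩
      obtain ⟨e, e1, e2⟩ := h.2 _ (S.addLine A hA) (addLine_KF S A hA hn h.1 hAm hB) some
        ⟨Option.some_injective M, fun _ => Iff.rfl, fun _ _ => Iff.rfl⟩ (↑(A ∪ G))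
        (insert none (some '' (↑(A ∪ G) : Set M))) (Finset.finite_toSet _)
        (((Finset.finite_toSet _).image _).insert _)
      have hs : ∀ x ∈ A ∪ G, some x ∈ (insert none (some '' (↑(A ∪ G) : Set M)) : Set (Option M)) :=
        fun x hx => Or.inr ⟨x, hx, rfl⟩
      set z := e ⟨none, Or.inl rfl⟩ with hz
      have hzA : ∀ a ∈ A, S.inc a z := by
        intro a ha
        have hau := Finset.mem_union_left G ha
        have := (e1.inc ⟨some a, hs a hau⟩ ⟨none, Or.inl rfl⟩).2 ha
        rwa [e2 a hau] at this
      have hzG : z ∉ G := by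
        intro hzG
        have hu := Finset.mem_union_right A hzG
        have h3 := e2 z hu (hs z hu)
        have h4 := e1.inj (h3.trans hz)
        cases congrArg Subtype.val h4
      refine hno ⟨insert z G, by rw [Finset.card_insert_of_notMem hzG, g1], ?_⟩
      intro a ha b hb
      rcases Finset.mem_insert.1 hb with rfl | hb
      · exact hzA a ha
      · exact g2 a ha b hb
  obtain ⟨G, g1, g2⟩ := this _ le_rfl
  exact ⟨G, Set.subset_univ _, g1, g2⟩

theorem EC.tc {M : Type u} {S : Inc M} {m n : ℕ} (hm : 1 ≤ m) (hn : 1 ≤ n) (h : EC S m n) :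
    Tc S m n := ⟨h.1, h.hstep hn, h.swap.hstep hm⟩

theorem EC.ext {N D : Type u} {T : Inc N} {m n : ℕ} (h : EC T m n) {S : Inc D} [Finite D]
    (hS : KF S m n) (A : Set D) (g : A → N) (hg : IsE (S.comap Subtype.val) T g)
    (hc : Cl S m n A) : ∃ k : D → N, IsE S T k ∧ ∀ a : A, k a = g a := by
  obtain ⟨N', T', f, k, hT', hf, hk, hfk, -⟩ := exists_amalg T S A g hg h.1 hS hc
  obtain ⟨e, e1, e2⟩ := h.2 N' T' hT' f hf (Set.range g) (Set.range k) (Set.finite_range _)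
    (Set.finite_range _)
  refine ⟨fun d => e ⟨k d, d, rfl⟩, ?_, ?_⟩
  · refine ⟨fun x y hxy => hk.inj (congrArg Subtype.val (e1.inj hxy)), fun x => ?_, fun x y => ?_⟩
    · exact (e1.pt _).trans (hk.pt x)
    · exact (e1.inc _ _).trans (hk.inc x y)
  · intro a
    have h1 : f (g a) ∈ Set.range k := ⟨a, hfk a⟩
    exact (congrArg e (Subtype.ext (hfk a))).trans (e2 (g a) ⟨a, rfl⟩ h1)

/-- growth bound -/
def growF (m n s : ℕ) : ℕ := s + (2 ^ s * n + 2 ^ s * m)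

theorem growF_mono (m n : ℕ) : Monotone (growF m n) := by
  intro a b hab
  have : 2 ^ a ≤ 2 ^ b := Nat.pow_le_pow_right (by norm_num) hab
  unfold growF
  gcongr

theorem HStep.grow {M : Type*} {S : Inc M} {m n : ℕ} (h : HStep S m n Set.univ Set.univ)
    (A : Finset M) : ∃ A' : Finset M, A'.card ≤ 2 ^ A.card * n ∧ HStep S m n ↑A ↑A' := by
  classical
  have : ∀ F : Finset M, ∃ G : Finset M, G.card ≤ n ∧
      ((∀ a ∈ F, S.pt a) → F.card = m → G.card = n - 1 ∧ ∀ a ∈ F, ∀ b ∈ G, S.inc a b) := by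
    intro F
    by_cases hF : (∀ a ∈ F, S.pt a) ∧ F.card = m
    · obtain ⟨G, -, g2, g3⟩ := h F (Set.subset_univ _) hF.1 hF.2
      exact ⟨G, by omega, fun _ _ => ⟨g2, g3⟩⟩
    · exact ⟨∅, by simp, fun h1 h2 => absurd ⟨h1, h2⟩ hF⟩
  choose G g1 g2 using this
  refine ⟨A.powerset.biUnion G, ?_, ?_⟩
  · have := Finset.card_biUnion_le_card_mul A.powerset G n (fun x _ => g1 x)
    rwa [Finset.card_powerset] at this
  · intro F hF hp hc
    refine ⟨G F, ?_, (g2 F hp hc).1, (g2 F hp hc).2⟩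
    intro x hx
    exact Finset.mem_coe.2 (Finset.mem_biUnion.2 ⟨F, Finset.mem_powerset.2 (by exact_mod_cast hF), hx⟩)

theorem HStep.mono {X : Type*} {S : Inc X} {m n : ℕ} {A A' B B' : Set X} (h : HStep S m n A A')
    (hB : B ⊆ A) (hB' : A' ⊆ B') : HStep S m n B B' := by
  intro F hF hp hc
  obtain ⟨G, g1, g2⟩ := h F (hF.trans hB) hp hc
  exact ⟨G, g1.trans hB', g2⟩

theorem Tc.grow {M : Type*} {S : Inc M} {m n : ℕ} (h : Tc S m n) (A : Finset M) :
    ∃ A' : Finset M, A ⊆ A' ∧ A'.card ≤ growF m n A.card ∧ Step S m n ↑A ↑A' := by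
  classical
  obtain ⟨B, b1, b2⟩ := h.2.1.grow A
  obtain ⟨C, c1, c2⟩ := h.2.2.grow A
  refine ⟨A ∪ (B ∪ C), Finset.subset_union_left, ?_, b2.mono subset_rfl ?_, c2.mono subset_rfl ?_⟩
  · refine (Finset.card_union_le _ _).trans ?_
    have := Finset.card_union_le B C
    unfold growF; omega
  · intro x hx; simp only [Finset.coe_union]; exact Or.inr (Or.inl hx)
  · intro x hx; simp only [Finset.coe_union]; exact Or.inr (Or.inr hx)

theorem Tc.chain {M : Type*} {S : Inc M} {m n : ℕ} (h : Tc S m n) (A : Finset M) :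
    ∃ C : ℕ → Finset M, C 0 = A ∧ (∀ i, C i ⊆ C (i + 1)) ∧ (∀ i, Step S m n ↑(C i) ↑(C (i + 1))) ∧
      ∀ i, (C i).card ≤ (growF m n)^[i] A.card := by
  choose G g1 g2 g3 using h.grow
  refine ⟨fun i => G^[i] A, rfl, fun i => ?_, fun i => ?_, fun i => ?_⟩
  · simp only [Function.iterate_succ_apply']; exact g1 _
  · simp only [Function.iterate_succ_apply']; exact g3 _
  · induction i with
    | zero => rfl
    | succ i ih =>
      simp only [Function.iterate_succ_apply']
      exact (g2 _).trans (growF_mono m n ih)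

/-- `r`-step similarity of tuples. -/
def Sim {ι : Type*} {M N : Type u} (S : Inc M) (T : Inc N) (m n r : ℕ) (a : ι → M) (b : ι → N) :
    Prop :=
  ∃ (X : Type u) (R : Inc X) (p : X → M) (q : X → N) (x : ι → X) (C : ℕ → Set X),
    IsE R S p ∧ IsE R T q ∧ (∀ i, x i ∈ C 0) ∧ (∀ i, p (x i) = a i) ∧ (∀ i, q (x i) = b i) ∧
    ∀ i < r, C i ⊆ C (i + 1) ∧ Step R m n (C i) (C (i + 1))

theorem Sim.symm {ι : Type*} {M N : Type u} {S : Inc M} {T : Inc N} {m n r : ℕ} {a : ι → M}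
    {b : ι → N} (h : Sim S T m n r a b) : Sim T S m n r b a := by
  obtain ⟨X, R, p, q, x, C, h1, h2, h3, h4, h5, h6⟩ := h
  exact ⟨X, R, q, p, x, C, h2, h1, h3, h5, h4, h6⟩

theorem Sim.mono {ι : Type*} {M N : Type u} {S : Inc M} {T : Inc N} {m n r r' : ℕ} {a : ι → M}
    {b : ι → N} (h : Sim S T m n r a b) (hr : r' ≤ r) : Sim S T m n r' a b := by
  obtain ⟨X, R, p, q, x, C, h1, h2, h3, h4, h5, h6⟩ := h
  exact ⟨X, R, p, q, x, C, h1, h2, h3, h4, h5, fun i hi => h6 i (by omega)⟩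

theorem Sim.reindex {ι κ : Type*} {M N : Type u} {S : Inc M} {T : Inc N} {m n r : ℕ} {a : ι → M}
    {b : ι → N} (h : Sim S T m n r a b) (s : κ → ι) : Sim S T m n r (a ∘ s) (b ∘ s) := by
  obtain ⟨X, R, p, q, x, C, h1, h2, h3, h4, h5, h6⟩ := h
  exact ⟨X, R, p, q, x ∘ s, C, h1, h2, fun i => h3 _, fun i => h4 _, fun i => h5 _, h6⟩

theorem exists_stable {X : Type*} (W : ℕ → Finset X) (s : ℕ) (hW : ∀ j ≤ s, W j ⊆ W (j + 1))
    (hs : ∀ j, (W j).card ≤ s) : ∃ j ≤ s, W j = W (j + 1) := by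
  by_contra hno
  push Not at hno
  have : ∀ j, j ≤ s + 1 → j ≤ (W j).card := by
    intro j
    induction j with
    | zero => simp
    | succ j ih =>
      intro hj
      have h1 := ih (by omega)
      have h2 : W j ⊂ W (j + 1) := (hW j (by omega)).ssubset_of_ne (hno j (by omega))
      have := Finset.card_lt_card h2
      omega
  have h1 := this (s + 1) le_rfl
  have h2 := hs (s + 1)
  omega

theorem Sim.forth {ι : Type*} [Fintype ι] {M N : Type u} {S : Inc M} {T : Inc N} {m n r : ℕ}
    (hm : 1 ≤ m) (hn : 1 ≤ n) (hS : EC S m n) (hT : EC T m n) {a : ι → M} {b : ι → N}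
    (h : Sim S T m n ((growF m n)^[r] (Fintype.card ι + 1) + 1) a b) (c : M) :
    ∃ d : N, Sim S T m n r (fun o : Option ι => o.elim c a) (fun o => o.elim d b) := by
  classical
  obtain ⟨X, R, p, q, x, C, hp, hq, hx, hxa, hxb, hC⟩ := h
  obtain ⟨E, E0, E1, E2, E3⟩ := (hS.tc hm hn).chain (Finset.univ.image (fun o : Option ι => o.elim c a))
  have hcard : (E r).card ≤ (growF m n)^[r] (Fintype.card ι + 1) := by
    refine (E3 r).trans ((growF_mono m n).iterate r ?_)
    refine Finset.card_image_le.trans ?_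
    simp
  obtain ⟨j, hj, hjW⟩ := exists_stable (fun j => (E r).filter (fun z => z ∈ p '' C j)) _
    (fun j hj z hz => by
      simp only [Finset.mem_filter] at hz ⊢
      exact ⟨hz.1, Set.image_mono (hC j (by omega)).1 hz.2⟩)
    (fun j => (Finset.card_filter_le _ _).trans hcard)
  -- the finite structure to be embedded
  have hEmono : Monotone E := monotone_nat_of_le_succ E1
  have hC0 : ∀ j, j ≤ (growF m n)^[r] (Fintype.card ι + 1) + 1 → C 0 ⊆ C j := by
    intro j
    induction j with
    | zero => exact fun _ => subset_rfl
    | succ j ih => exact fun hj => (ih (by omega)).trans (hC j (by omega)).1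
  let D := {z : M // z ∈ E r}
  let D' := {z : M // z ∈ E r ∧ z ∈ p '' C j}
  let SD : Inc D := S.comap Subtype.val
  have hSD : IsE SD S Subtype.val := isE_comap S Subtype.val_injective
  let A : Set D := {z | z.1 ∈ p '' C j}
  let g : A → N := fun z => q z.2.choose
  have hgspec : ∀ z : A, p z.2.choose = z.1.1 := fun z => z.2.choose_spec.2
  have hg : IsE (SD.comap Subtype.val) T g := by
    refine ⟨?_, fun z => ?_, fun z w => ?_⟩
    · intro z w hzw
      have := hq.inj hzw
      apply Subtype.ext; apply Subtype.ext
      rw [← hgspec z, ← hgspec w, this]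
    · refine (hq.pt _).trans ((hp.pt _).symm.trans ?_)
      rw [hgspec z]; exact Iff.rfl
    · refine (hq.inc _ _).trans ((hp.inc _ _).symm.trans ?_)
      rw [hgspec z, hgspec w]; exact Iff.rfl
  have hnot : ∀ d : D, d ∉ A → d.1 ∉ p '' C (j + 1) := by
    intro d hd hd'
    have : d.1 ∈ (E r).filter (fun z => z ∈ p '' C (j + 1)) := Finset.mem_filter.2 ⟨d.2, hd'⟩
    rw [← hjW] at this
    exact hd (Finset.mem_filter.1 this).2
  have hpush := (hC j (by omega)).2.push hp
  have hcl : Cl SD m n A := by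
    constructor
    · intro d hd F hF hi
      have := HStep.lt (F := F.map ⟨_, hSD.inj⟩) hn hS.1 hpush.1 (hnot d hd)
        (by intro y hy
            simp only [Finset.coe_map, Function.Embedding.coeFn_mk] at hy
            obtain ⟨y, hy, rfl⟩ := hy
            exact hF hy)
        (by intro y hy
            obtain ⟨y', hy', rfl⟩ := Finset.mem_map.1 hy
            exact hi y' hy')
      simpa using this
    · intro d hd F hF hi
      have := HStep.lt (F := F.map ⟨_, hSD.inj⟩) hm hS.1.swap hpush.2 (hnot d hd)
        (by intro y hy
            simp only [Finset.coe_map, Function.Embedding.coeFn_mk] at hy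
            obtain ⟨y, hy, rfl⟩ := hy
            exact hF hy)
        (by intro y hy
            obtain ⟨y', hy', rfl⟩ := Finset.mem_map.1 hy
            exact hi y' hy')
      simpa using this
  obtain ⟨k, hk, hkA⟩ := hT.ext (hS.1.of_isE hSD) A g hg hcl
  have hmem0 : ∀ o : Option ι, o.elim c a ∈ E 0 := by
    intro o; rw [E0]; exact Finset.mem_image_of_mem _ (Finset.mem_univ o)
  have hmem : ∀ o : Option ι, o.elim c a ∈ E r := fun o => hEmono (Nat.zero_le r) (hmem0 o)
  refine ⟨k ⟨c, hmem none⟩, D, SD, Subtype.val, k, fun o => ⟨_, hmem o⟩,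
    fun i => Subtype.val ⁻¹' (E i : Set M), hSD, hk, hmem0, fun _ => rfl, ?_, ?_⟩
  · rintro (_ | i)
    · rfl
    · have hA : (⟨a i, hmem (some i)⟩ : D) ∈ A := ⟨x i, hC0 j (by omega) (hx i), hxa i⟩
      refine (hkA ⟨_, hA⟩).trans ?_
      have := hgspec ⟨_, hA⟩
      have h2 := hp.inj (this.trans (hxa i).symm)
      show q _ = b i
      rw [← hxb i]
      exact congrArg q h2
  · intro i hi
    refine ⟨Set.preimage_mono (by exact_mod_cast E1 i), (E2 i).pull hSD ?_⟩
    intro z hz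
    exact ⟨⟨z, hEmono (show i + 1 ≤ r by omega) hz⟩, rfl⟩

theorem Tc.cl {X Y : Type*} {R : Inc X} {S : Inc Y} {f : X → Y} {m n : ℕ} (hm : 1 ≤ m)
    (hn : 1 ≤ n) (h : Tc R m n) (hf : IsE R S f) (hS : KF S m n) : Cl S m n (Set.range f) := by
  have := h.2.push hf
  rw [Set.image_univ] at this
  exact ⟨fun d hd F hF hi => this.1.lt hn hS hd hF hi,
    fun d hd F hF hi => this.2.lt hm hS.swap hd hF hi⟩

theorem Tc.of_surj {X Y : Type*} {R : Inc X} {S : Inc Y} {f : X → Y} {m n : ℕ}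
    (h : Tc R m n) (hf : IsE R S f) (hs : Function.Surjective f) : Tc S m n := by
  refine ⟨?_, ?_⟩
  · obtain ⟨g, hg⟩ := hs.hasRightInverse
    refine h.1.of_isE (f := g) (hf.of_comp ?_)
    have : f ∘ g = id := funext hg
    rw [this]
    exact ⟨Function.injective_id, fun _ => Iff.rfl, fun _ _ => Iff.rfl⟩
  · have := h.2.push hf
    rwa [Set.image_univ, hs.range_eq] at this

def rawInc (d : Finset ℕ × Finset ℕ × Finset (ℕ × ℕ)) : Inc ℕ where
  pt x := x ∈ d.2.1
  inc x y := (x, y) ∈ d.2.2 ∧ x ∈ d.2.1 ∧ y ∉ d.2.1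
  inc_pt h := h.2.1
  inc_ln h := h.2.2

def rawS (d : Finset ℕ × Finset ℕ × Finset (ℕ × ℕ)) : Inc (ULift.{u} {x // x ∈ d.1}) :=
  (rawInc d).comap (fun x => x.down.1)

/-- finite structures in `T^c` on finite sets of natural numbers -/
def St (m n : ℕ) : Type :=
  {d : Finset ℕ × Finset ℕ × Finset (ℕ × ℕ) // Tc (rawS.{u} d) m n}

namespace St

variable {m n : ℕ}

def Ty (A : St.{u} m n) : Type u := ULift.{u} {x // x ∈ A.1.1}

instance (A : St.{u} m n) : Finite A.Ty := by unfold Ty; infer_instance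

def val {A : St.{u} m n} (x : A.Ty) : ℕ := x.down.1

theorem val_inj {A : St.{u} m n} : Function.Injective (val (A := A)) := by
  intro x y h
  exact ULift.down_injective (Subtype.ext h)

def S (A : St.{u} m n) : Inc A.Ty := rawS.{u} A.1

theorem tc (A : St.{u} m n) : Tc A.S m n := A.2

instance : Countable (St.{u} m n) := by unfold St; infer_instance

instance : Preorder (St.{u} m n) where
  le A B := ∃ f : A.Ty → B.Ty, IsE A.S B.S f ∧ ∀ x, val (f x) = val x
  le_refl A := ⟨id, ⟨Function.injective_id, fun _ => Iff.rfl, fun _ _ => Iff.rfl⟩, fun _ => rfl⟩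
  le_trans A B C h1 h2 := by
    obtain ⟨f, hf, f'⟩ := h1
    obtain ⟨g, hg, g'⟩ := h2
    exact ⟨g ∘ f, hg.comp hf, fun x => (g' _).trans (f' x)⟩

theorem le_iff {A B : St.{u} m n} :
    A ≤ B ↔ ∃ f : A.Ty → B.Ty, IsE A.S B.S f ∧ ∀ x, val (f x) = val x := Iff.rfl

theorem exists_empty (hm : 1 ≤ m) (hn : 1 ≤ n) : Nonempty (St.{u} m n) := by
  refine ⟨⟨(∅, ∅, ∅), ?_⟩⟩
  have he : ∀ F : Finset (ULift.{u} {x : ℕ // x ∈ (∅ : Finset ℕ)}), F = ∅ := by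
    intro F
    refine Finset.eq_empty_of_forall_notMem fun x _ => ?_
    exact absurd x.down.2 (Finset.notMem_empty _)
  refine ⟨fun A B _ => ?_, fun F _ _ hc => ?_, fun F _ _ hc => ?_⟩
  · left; rw [he A, Finset.card_empty]; omega
  · rw [he F, Finset.card_empty] at hc; omega
  · rw [he F, Finset.card_empty] at hc; omega

theorem mk_ext (A : St.{u} m n) {E : Type u} [Finite E] (T : Inc E) (hT : Tc T m n)
    (j : A.Ty → E) (hj : IsE A.S T j) :
    ∃ B : St.{u} m n, A ≤ B ∧ ∃ e : E → B.Ty, IsE T B.S e ∧ ∀ x, val (e (j x)) = val x := by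
  classical
  have : Fintype E := Fintype.ofFinite E
  obtain ⟨K, hK⟩ : ∃ K, ∀ x : A.Ty, val x < K := by
    obtain ⟨K, hK⟩ := (Set.finite_range (val (A := A))).bddAbove
    exact ⟨K + 1, fun x => Nat.lt_succ_of_le (hK ⟨x, rfl⟩)⟩
  obtain ⟨ε, hε, hεj⟩ : ∃ ε : E → ℕ, Function.Injective ε ∧ ∀ x, ε (j x) = val x := by
    let idx : E → ℕ := fun y => (Fintype.equivFin E y).1
    have hidx : Function.Injective idx :=
      fun x y h => (Fintype.equivFin E).injective (Fin.ext h)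
    let ε : E → ℕ := fun y => if h : ∃ x, j x = y then val h.choose else K + idx y
    have h1 : ∀ x, ε (j x) = val x := by
      intro x
      have h : ∃ x', j x' = j x := ⟨x, rfl⟩
      have : ε (j x) = val h.choose := dif_pos h
      rw [this, hj.inj h.choose_spec]
    have h2 : ∀ y, (¬ ∃ x, j x = y) → ε y = K + idx y := fun y hy => dif_neg hy
    refine ⟨ε, ?_, h1⟩
    intro y z hyz
    by_cases hy : ∃ x, j x = y <;> by_cases hz : ∃ x, j x = z
    · obtain ⟨x, rfl⟩ := hy
      obtain ⟨x', rfl⟩ := hz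
      rw [h1, h1] at hyz
      rw [val_inj hyz]
    · obtain ⟨x, rfl⟩ := hy
      rw [h1, h2 z hz] at hyz
      have := hK x; omega
    · obtain ⟨x, rfl⟩ := hz
      rw [h1, h2 y hy] at hyz
      have := hK x; omega
    · rw [h2 y hy, h2 z hz] at hyz
      exact hidx (by omega)
  let d : Finset ℕ × Finset ℕ × Finset (ℕ × ℕ) :=
    (Finset.univ.image ε, (Finset.univ.filter T.pt).image ε,
      (Finset.univ.filter (fun z : E × E => T.inc z.1 z.2)).image (fun z => (ε z.1, ε z.2)))
  let e : E → ULift.{u} {x // x ∈ d.1} :=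
    fun y => ⟨⟨ε y, Finset.mem_image_of_mem _ (Finset.mem_univ y)⟩⟩
  have hpt : ∀ y, ε y ∈ d.2.1 ↔ T.pt y := by
    intro y
    simp only [d, Finset.mem_image, Finset.mem_filter, Finset.mem_univ, true_and]
    constructor
    · rintro ⟨z, hz, hzy⟩; rwa [← hε hzy]
    · exact fun h => ⟨y, h, rfl⟩
  have hinc : ∀ y z, (ε y, ε z) ∈ d.2.2 ↔ T.inc y z := by
    intro y z
    simp only [d, Finset.mem_image, Finset.mem_filter, Finset.mem_univ, true_and, Prod.mk.injEq,
      Prod.exists]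
    constructor
    · rintro ⟨y', z', h, h1, h2⟩
      rwa [← hε h1, ← hε h2]
    · exact fun h => ⟨y, z, h, rfl, rfl⟩
  have he : IsE T (rawS.{u} d) e := by
    refine ⟨?_, hpt, ?_⟩
    · intro y z h
      exact hε (congrArg (fun w => w.down.1) h)
    · intro y z
      constructor
      · exact fun h => (hinc y z).1 h.1
      · exact fun h => ⟨(hinc y z).2 h, (hpt y).2 (T.inc_pt h), fun h' => T.inc_ln h ((hpt z).1 h')⟩
  have hes : Function.Surjective e := by
    rintro ⟨⟨x, hx⟩⟩
    obtain ⟨y, -, rfl⟩ := Finset.mem_image.1 hx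
    exact ⟨y, rfl⟩
  refine ⟨⟨d, hT.of_surj he hes⟩, ⟨e ∘ j, he.comp hj, hεj⟩, e, he, hεj⟩

theorem exists_limit (s : ℕ → St.{u} m n) (hs : Monotone s) :
    ∃ (M : Type u) (MS : Inc M) (i : ∀ k, (s k).Ty → M), (∀ k, IsE (s k).S MS (i k)) ∧
      (∀ k l (y : (s k).Ty) (z : (s l).Ty), i k y = i l z ↔ val y = val z) ∧
      ∀ x, ∃ k y, i k y = x := by
  have hle : ∀ k l, k ≤ l → ∃ f : (s k).Ty → (s l).Ty, IsE (s k).S (s l).S f ∧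
    ∀ x, val (f x) = val x := fun k l h => hs h
  have ptc : ∀ k l (y : (s k).Ty) (z : (s l).Ty), val y = val z →
      ((s k).S.pt y ↔ (s l).S.pt z) := by
    intro k l y z h
    obtain ⟨f, hf, f'⟩ := hle k (max k l) (le_max_left _ _)
    obtain ⟨g, hg, g'⟩ := hle l (max k l) (le_max_right _ _)
    rw [← hf.pt y, ← hg.pt z, val_inj (((f' y).trans h).trans (g' z).symm)]
  have incc : ∀ k l (y y' : (s k).Ty) (z z' : (s l).Ty), val y = val z → val y' = val z' →
      ((s k).S.inc y y' ↔ (s l).S.inc z z') := by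
    intro k l y y' z z' h h'
    obtain ⟨f, hf, f'⟩ := hle k (max k l) (le_max_left _ _)
    obtain ⟨g, hg, g'⟩ := hle l (max k l) (le_max_right _ _)
    rw [← hf.inc y, ← hg.inc z, val_inj (((f' y).trans h).trans (g' z).symm),
      val_inj (((f' y').trans h').trans (g' z').symm)]
  let M := ULift.{u} {x : ℕ // ∃ k, ∃ y : (s k).Ty, val y = x}
  let MS : Inc M :=
    { pt := fun x => ∃ k, ∃ y : (s k).Ty, val y = x.down.1 ∧ (s k).S.pt y
      inc := fun x x' => ∃ k, ∃ y y' : (s k).Ty, val y = x.down.1 ∧ val y' = x'.down.1 ∧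
        (s k).S.inc y y'
      inc_pt := by
        rintro x x' ⟨k, y, y', h1, h2, h3⟩
        exact ⟨k, y, h1, (s k).S.inc_pt h3⟩
      inc_ln := by
        rintro x x' ⟨k, y, y', h1, h2, h3⟩ ⟨l, z, hz, hp⟩
        exact (s k).S.inc_ln h3 ((ptc _ _ _ _ (h2.trans hz.symm)).2 hp) }
  refine ⟨M, MS, fun k y => ⟨⟨val y, k, y, rfl⟩⟩, fun k => ⟨?_, ?_, ?_⟩, ?_, ?_⟩
  · intro y z h
    exact val_inj (congrArg (fun w : M => w.down.1) h)
  · intro y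
    constructor
    · rintro ⟨l, z, h, hz⟩
      exact (ptc _ _ _ _ h).1 hz
    · exact fun h => ⟨k, y, rfl, h⟩
  · intro y y'
    constructor
    · rintro ⟨l, z, z', h, h', hz⟩
      exact (incc _ _ _ _ _ _ h h').1 hz
    · exact fun h => ⟨k, y, y', rfl, rfl, h⟩
  · intro k l y z
    constructor
    · exact fun h => congrArg (fun w : M => w.down.1) h
    · intro h
      exact ULift.down_injective (Subtype.ext h)
  · rintro ⟨⟨x, k, y, rfl⟩⟩
    exact ⟨k, y, rfl⟩

/-- the hypothesis `H` in abstract form -/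
def Hyp (m n : ℕ) : Prop := ∀ (A : Type u) (S : Inc A), Finite A → KF S m n →
  ∃ (E : Type u) (T : Inc E) (j : A → E), Finite E ∧ Tc T m n ∧ IsE S T j

def task (A B : St.{u} m n) (i : A.Ty → B.Ty) : Set (St.{u} m n) :=
  {C | (∃ h : B.Ty → C.Ty, IsE B.S C.S h ∧ ∀ x, val (h (i x)) = val x) ∨ ∀ C' ≥ C, ¬ A ≤ C'}

theorem task_cofinal (H : Hyp.{u} m n) (hm : 1 ≤ m) (hn : 1 ≤ n) (A B : St.{u} m n)
    (i : A.Ty → B.Ty) (hi : IsE A.S B.S i) : IsCofinal (task A B i) := by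
  classical
  intro C
  by_cases hC : ∀ C' ≥ C, ¬ A ≤ C'
  · exact ⟨C, Or.inr hC, le_rfl⟩
  push Not at hC
  obtain ⟨C', hCC', f, hf, f'⟩ := hC
  let g : Set.range i → C'.Ty := fun z => f z.2.choose
  have hgs : ∀ z : Set.range i, i z.2.choose = z.1 := fun z => z.2.choose_spec
  have hg : IsE (B.S.comap Subtype.val) C'.S g := by
    refine ⟨?_, fun z => ?_, fun z w => ?_⟩
    · intro z w hzw
      have := hf.inj hzw
      apply Subtype.ext
      rw [← hgs z, ← hgs w, this]
    · refine (hf.pt _).trans ((hi.pt _).symm.trans ?_)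
      rw [hgs z]; exact Iff.rfl
    · refine (hf.inc _ _).trans ((hi.inc _ _).symm.trans ?_)
      rw [hgs z, hgs w]; exact Iff.rfl
  obtain ⟨N', T', p, q, hT', hp, hq, hpq, hcov⟩ := exists_amalg C'.S B.S (Set.range i) g hg
    C'.tc.1 B.tc.1 (A.tc.cl hm hn hi B.tc.1)
  have : Finite N' := by
    have : (Set.univ : Set N').Finite :=
      ((Set.finite_range p).union (Set.finite_range q)).subset (fun x _ => hcov x)
    exact Set.finite_univ_iff.1 this
  obtain ⟨E, T, j, hE, hT, hj⟩ := H N' T' this hT'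
  obtain ⟨D, hD, e, he, he'⟩ := mk_ext C' T hT (j ∘ p) (hj.comp hp)
  refine ⟨D, Or.inl ⟨e ∘ j ∘ q, he.comp (hj.comp hq), fun x => ?_⟩, hCC'.trans hD⟩
  have h1 : q (i x) = p (f x) := by
    rw [hpq ⟨i x, x, rfl⟩]
    exact congrArg p (congrArg f (hi.inj (hgs ⟨i x, x, rfl⟩)))
  show val (e (j (q (i x)))) = val x
  rw [h1]
  exact (he' (f x)).trans (f' x)

theorem exists_generic (H : Hyp.{u} m n) (hm : 1 ≤ m) (hn : 1 ≤ n) :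
    ∃ s : ℕ → St.{u} m n, Monotone s ∧ ∀ k (B : St.{u} m n) (i : (s k).Ty → B.Ty),
      IsE (s k).S B.S i → ∃ l, ∃ h : B.Ty → (s l).Ty, IsE B.S (s l).S h ∧
        ∀ x, val (h (i x)) = val x := by
  let I := {z : (Σ A : St.{u} m n, Σ B : St.{u} m n, A.Ty → B.Ty) // IsE z.1.S z.2.1.S z.2.2}
  have : Encodable I := Encodable.ofCountable I
  let DD : I → Order.Cofinal (St.{u} m n) := fun z =>
    ⟨task z.1.1 z.1.2.1 z.1.2.2, task_cofinal H hm hn _ _ _ z.2⟩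
  obtain ⟨p⟩ := exists_empty.{u} hm hn
  refine ⟨Order.sequenceOfCofinals p DD, Order.sequenceOfCofinals.monotone p DD, ?_⟩
  intro k B i hi
  have := Order.sequenceOfCofinals.encode_mem p DD ⟨⟨_, B, i⟩, hi⟩
  rcases this with h | h
  · exact ⟨_, h⟩
  · exact absurd (Order.sequenceOfCofinals.monotone p DD (le_max_right _ k))
      (h _ (Order.sequenceOfCofinals.monotone p DD (le_max_left _ _)))

theorem exists_prime (H : Hyp.{u} m n) (hm : 1 ≤ m) (hn : 1 ≤ n) :
    ∃ (M : Type u) (MS : Inc M), EC MS m n ∧ ∀ (N : Type u) (T : Inc N), EC T m n →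
      ∃ G : M → N, ∀ (κ : Type) [Finite κ] (a : κ → M) (r : ℕ), Sim MS T m n r a (G ∘ a) := by
  classical
  obtain ⟨s, hs, hgen⟩ := exists_generic H hm hn
  obtain ⟨M, MS, i, hi, hval, hcov⟩ := exists_limit s hs
  have hle : ∀ k l, k ≤ l → ∃ f : (s k).Ty → (s l).Ty, IsE (s k).S (s l).S f ∧
    ∀ x, val (f x) = val x := fun k l h => hs h
  have hup : ∀ k l, k ≤ l → ∀ y, ∃ z, i l z = i k y := by
    intro k l hkl y
    obtain ⟨f, -, f'⟩ := hle k l hkl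
    exact ⟨f y, (hval _ _ _ _).2 (f' y)⟩
  have hfin : ∀ F : Set M, F.Finite → ∃ k, F ⊆ Set.range (i k) := by
    intro F hF
    induction F, hF using Set.Finite.induction_on with
    | empty => exact ⟨0, Set.empty_subset _⟩
    | @insert x F _ _ ih =>
      obtain ⟨k, hk⟩ := ih
      obtain ⟨l, y, rfl⟩ := hcov x
      refine ⟨max k l, Set.insert_subset ?_ ?_⟩
      · exact hup _ _ (le_max_right _ _) _
      · intro z hz
        obtain ⟨w, rfl⟩ := hk hz
        exact hup _ _ (le_max_left _ _) _
  have hKF : KF MS m n := by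
    intro A B hAB
    obtain ⟨k, hk⟩ := hfin (↑(A ∪ B)) (Finset.finite_toSet _)
    obtain ⟨A', -, rfl⟩ := exists_map (hi k).inj (s := Set.univ) (t := A) (fun a ha => by
      simpa using hk (Finset.mem_coe.2 (Finset.mem_union_left _ ha)))
    obtain ⟨B', -, rfl⟩ := exists_map (hi k).inj (s := Set.univ) (t := B) (fun a ha => by
      simpa using hk (Finset.mem_coe.2 (Finset.mem_union_right _ ha)))
    simpa using (s k).tc.1 A' B' fun a ha b hb => ((hi k).inc _ _).1
      (hAB _ (Finset.mem_map_of_mem _ ha) _ (Finset.mem_map_of_mem _ hb))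
  refine ⟨M, MS, ⟨hKF, ?_⟩, ?_⟩
  · intro N T hT f hf F B hF hB
    obtain ⟨k, hk⟩ := hfin F hF
    let Z : Set N := B ∪ Set.range (f ∘ i k)
    have hZ : Z.Finite := hB.union (Set.finite_range _)
    have : Finite Z := hZ
    have hZE : IsE (T.comap (Subtype.val : Z → N)) T Subtype.val :=
      isE_comap T Subtype.val_injective
    obtain ⟨E, U, j, hE, hU, hj⟩ := H Z (T.comap Subtype.val) this (hT.of_isE hZE)
    let w : (s k).Ty → Z := fun y => ⟨f (i k y), Or.inr ⟨y, rfl⟩⟩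
    have hw : IsE (s k).S (T.comap (Subtype.val : Z → N)) w :=
      hZE.of_comp (hf.comp (hi k))
    obtain ⟨D, -, e, he, he'⟩ := mk_ext (s k) U hU (j ∘ w) (hj.comp hw)
    obtain ⟨l, h, hh, hh'⟩ := hgen k D (e ∘ j ∘ w) (he.comp (hj.comp hw))
    let b : B → Z := fun z => ⟨z.1, Or.inl z.2⟩
    have hb : IsE (T.comap (Subtype.val : B → N)) (T.comap (Subtype.val : Z → N)) b :=
      hZE.of_comp (isE_comap T Subtype.val_injective)
    refine ⟨i l ∘ h ∘ e ∘ j ∘ b, (hi l).comp (hh.comp (he.comp (hj.comp hb))), ?_⟩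
    intro a ha hfa
    obtain ⟨y, rfl⟩ := hk ha
    exact (hval _ _ _ _).2 (hh' y)
  · intro N T hT
    have base : ∃ g : (s 0).Ty → N, IsE (s 0).S T g := by
      obtain ⟨g, hg, -⟩ := hT.ext (S := (s 0).S) (s 0).tc.1 ∅ (fun z => z.2.elim)
        ⟨fun z => z.2.elim, fun z => z.2.elim, fun z => z.2.elim⟩
        ⟨fun d _ F hF _ => by
            rw [Set.subset_empty_iff, Finset.coe_eq_empty] at hF
            rw [hF, Finset.card_empty]; omega,
          fun d _ F hF _ => by
            rw [Set.subset_empty_iff, Finset.coe_eq_empty] at hF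
            rw [hF, Finset.card_empty]; omega⟩
      exact ⟨g, hg⟩
    have step : ∀ k (g : {g : (s k).Ty → N // IsE (s k).S T g}),
        ∃ g' : {g : (s (k + 1)).Ty → N // IsE (s (k + 1)).S T g},
          ∀ y z, val y = val z → g'.1 z = g.1 y := by
      rintro k ⟨g, hg⟩
      obtain ⟨f, hf, f'⟩ := hle k (k + 1) (Nat.le_succ k)
      let c : Set.range f → N := fun z => g z.2.choose
      have hcs : ∀ z : Set.range f, f z.2.choose = z.1 := fun z => z.2.choose_spec
      have hc : IsE ((s (k + 1)).S.comap Subtype.val) T c := by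
        refine ⟨?_, fun z => ?_, fun z w => ?_⟩
        · intro z w hzw
          have := hg.inj hzw
          apply Subtype.ext
          rw [← hcs z, ← hcs w, this]
        · refine (hg.pt _).trans ((hf.pt _).symm.trans ?_)
          rw [hcs z]; exact Iff.rfl
        · refine (hg.inc _ _).trans ((hf.inc _ _).symm.trans ?_)
          rw [hcs z, hcs w]; exact Iff.rfl
      obtain ⟨g', hg', h'⟩ := hT.ext (S := (s (k + 1)).S) (s (k + 1)).tc.1 (Set.range f) c hc
        ((s k).tc.cl hm hn hf (s (k + 1)).tc.1)
      refine ⟨⟨g', hg'⟩, fun y z hyz => ?_⟩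
      have hz : f y = z := val_inj ((f' y).trans hyz)
      subst hz
      refine (h' ⟨f y, y, rfl⟩).trans ?_
      exact congrArg g (hf.inj (hcs ⟨f y, y, rfl⟩))
    choose nx hnx using step
    let g : ∀ k, {g : (s k).Ty → N // IsE (s k).S T g} := fun k =>
      Nat.rec (motive := fun k => {g : (s k).Ty → N // IsE (s k).S T g})
        ⟨base.choose, base.choose_spec⟩ nx k
    have hg1 : ∀ k y z, val y = val z → (g (k + 1)).1 z = (g k).1 y := fun k => hnx k (g k)
    have hg2 : ∀ k l, k ≤ l → ∀ (y : (s k).Ty) (z : (s l).Ty), val y = val z →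
        (g l).1 z = (g k).1 y := by
      intro k l hkl
      induction l, hkl using Nat.le_induction with
      | base => intro y z h; rw [val_inj h]
      | succ l hl ih =>
        intro y z h
        obtain ⟨f, hf, f'⟩ := hle k l hl
        rw [hg1 l (f y) z ((f' y).trans h)]
        exact ih y (f y) (f' y).symm
    choose κ' y' hy' using hcov
    let G : M → N := fun x => (g (κ' x)).1 (y' x)
    have hG : ∀ k (y : (s k).Ty), G (i k y) = (g k).1 y := by
      intro k y
      have h1 : val (y' (i k y)) = val y := (hval _ _ _ _).1 (hy' (i k y))
      rcases le_total (κ' (i k y)) k with h | h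
      · exact (hg2 _ _ h _ _ h1).symm
      · exact hg2 _ _ h _ _ h1.symm
    refine ⟨G, fun κ _ a r => ?_⟩
    obtain ⟨k, hk⟩ := hfin (Set.range a) (Set.finite_range a)
    choose x hx using fun t => hk ⟨t, rfl⟩
    refine ⟨(s k).Ty, (s k).S, i k, (g k).1, x, fun _ => Set.univ, hi k, (g k).2,
      fun _ => trivial, hx, fun t => ?_, fun _ _ => ⟨subset_rfl, (s k).tc.2⟩⟩
    rw [← hG, hx]; rfl

end St

def toStr {M : Type*} (S : Inc M) : IncLang.Structure M where
  funMap f := Empty.elim f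
  RelMap {k} r v := match k, r, v with
    | _, IncRel.pt, v => S.pt (v 0)
    | _, IncRel.lin, v => ¬ S.pt (v 0)
    | _, IncRel.inc, v => S.inc (v 0) (v 1)

def ofStr {M : Type u} [IncLang.Structure M] (h : IsIncidenceL M) : Inc M where
  pt := ptL
  inc := incL
  inc_pt h' := (h.2.2 _ _ h').1
  inc_ln h' := fun hp => h.2.1 _ ⟨hp, (h.2.2 _ _ h').2⟩

theorem isInc_toStr {M : Type u} (S : Inc M) : @IsIncidenceL M S.toStr := by
  letI := S.toStr
  refine ⟨fun x => em (S.pt x), fun x h => h.2 h.1, fun x y h => ⟨S.inc_pt h, S.inc_ln h⟩⟩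

theorem ofStr_toStr {M : Type u} (S : Inc M) : @ofStr M S.toStr (isInc_toStr S) = S := rfl

theorem ln_iff {M : Type u} [IncLang.Structure M] (h : IsIncidenceL M) (x : M) :
    lnL x ↔ ¬ ptL x :=
  ⟨fun h1 h2 => h.2.1 x ⟨h2, h1⟩, fun h1 => (h.1 x).resolve_left h1⟩

theorem relMap_pt {M : Type u} [IncLang.Structure M] (v : Fin 1 → M) :
    Structure.RelMap (L := IncLang) IncRel.pt v ↔ ptL (v 0) := by
  unfold ptL
  have : v = ![v 0] := by ext i; fin_cases i; rfl
  rw [← this]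

theorem relMap_lin {M : Type u} [IncLang.Structure M] (v : Fin 1 → M) :
    Structure.RelMap (L := IncLang) IncRel.lin v ↔ lnL (v 0) := by
  unfold lnL
  have : v = ![v 0] := by ext i; fin_cases i; rfl
  rw [← this]

theorem relMap_inc {M : Type u} [IncLang.Structure M] (v : Fin 2 → M) :
    Structure.RelMap (L := IncLang) IncRel.inc v ↔ incL (v 0) (v 1) := by
  unfold incL
  have : v = ![v 0, v 1] := by ext i; fin_cases i <;> rfl
  rw [← this]

theorem relMap_iff {X : Type*} {M N : Type u} [IncLang.Structure M] [IncLang.Structure N]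
    (hM : IsIncidenceL M) (hN : IsIncidenceL N) {R : Inc X} {p : X → M} {q : X → N}
    (hp : IsE R (ofStr hM) p) (hq : IsE R (ofStr hN) q) {l : ℕ} (r : IncLang.Relations l)
    (x : Fin l → X) :
    Structure.RelMap r (fun i => p (x i)) ↔ Structure.RelMap r (fun i => q (x i)) := by
  have h1 : ∀ y, ptL (p y) ↔ ptL (q y) := fun y => (hp.pt y).trans (hq.pt y).symm
  have h2 : ∀ y z, incL (p y) (p z) ↔ incL (q y) (q z) :=
    fun y z => (hp.inc y z).trans (hq.inc y z).symm
  change IncRel l at r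
  cases r with
  | pt =>
    exact (relMap_pt (fun i => p (x i))).trans
      ((h1 (x 0)).trans (relMap_pt (fun i => q (x i))).symm)
  | lin =>
    refine (relMap_lin _).trans (Iff.trans ?_ (relMap_lin _).symm)
    rw [ln_iff hM, ln_iff hN]
    exact not_congr (h1 _)
  | inc =>
    exact (relMap_inc (fun i => p (x i))).trans
      ((h2 (x 0) (x 1)).trans (relMap_inc (fun i => q (x i))).symm)

theorem isE_id {X : Type*} (S : Inc X) : IsE S S id :=
  ⟨Function.injective_id, fun _ => Iff.rfl, fun _ _ => Iff.rfl⟩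

def IsE.emb {M N : Type u} [IncLang.Structure M] [IncLang.Structure N]
    {hM : IsIncidenceL M} {hN : IsIncidenceL N} {f : M → N} (hf : IsE (ofStr hM) (ofStr hN) f) :
    M ↪[IncLang] N where
  toFun := f
  inj' := hf.inj
  map_fun' g := Empty.elim g
  map_rel' r x := relMap_iff hN hM hf (isE_id _) r x

theorem isE_emb {M N : Type u} [IncLang.Structure M] [IncLang.Structure N]
    (hM : IsIncidenceL M) (hN : IsIncidenceL N) (f : M ↪[IncLang] N) :
    IsE (ofStr hM) (ofStr hN) f := by
  refine ⟨f.injective, fun x => ?_, fun x y => ?_⟩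
  · have := f.map_rel (show IncLang.Relations 1 from IncRel.pt) ![x]
    exact (relMap_pt _).symm.trans (this.trans (relMap_pt _))
  · have := f.map_rel (show IncLang.Relations 2 from IncRel.inc) ![x, y]
    exact (relMap_inc _).symm.trans (this.trans (relMap_inc _))

theorem exists_fin {X : Type*} (A : Finset X) {m : ℕ} (h : A.card = m) :
    ∃ a : Fin m → X, Function.Injective a ∧ ∀ x, x ∈ A ↔ ∃ i, a i = x := by
  let e := A.equivFinOfCardEq h
  refine ⟨fun i => (e.symm i).1, fun i j hij => e.symm.injective (Subtype.ext hij), fun x => ?_⟩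
  constructor
  · exact fun hx => ⟨e ⟨x, hx⟩, by simp⟩
  · rintro ⟨i, rfl⟩; exact (e.symm i).2

theorem kf_of {M : Type u} [IncLang.Structure M] (hM : IsIncidenceL M) {m n : ℕ} (hm : 1 ≤ m)
    (hn : 1 ≤ n) (h : KFreeL m n M) : KF (ofStr hM) m n := by
  intro A B hAB
  by_contra hc
  push Not at hc
  obtain ⟨A', hA, hAc⟩ := Finset.exists_subset_card_eq hc.1
  obtain ⟨B', hB, hBc⟩ := Finset.exists_subset_card_eq hc.2
  obtain ⟨a, a1, a2⟩ := exists_fin A' hAc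
  obtain ⟨b, b1, b2⟩ := exists_fin B' hBc
  have hi : ∀ i j, incL (a i) (b j) :=
    fun i j => hAB _ (hA ((a2 _).2 ⟨i, rfl⟩)) _ (hB ((b2 _).2 ⟨j, rfl⟩))
  exact h ⟨a, b, a1, b1, fun i => (hM.2.2 _ _ (hi i ⟨0, hn⟩)).1,
    fun j => (hM.2.2 _ _ (hi ⟨0, hm⟩ j)).2, hi⟩

theorem kfree_of {M : Type u} [IncLang.Structure M] (hM : IsIncidenceL M) {m n : ℕ}
    (h : KF (ofStr hM) m n) : KFreeL m n M := by
  rintro ⟨a, b, ha, hb, -, -, hab⟩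
  have := h (Finset.univ.map ⟨a, ha⟩) (Finset.univ.map ⟨b, hb⟩) (by
    intro x hx y hy
    obtain ⟨i, -, rfl⟩ := Finset.mem_map.1 hx
    obtain ⟨j, -, rfl⟩ := Finset.mem_map.1 hy
    exact hab i j)
  simp at this

theorem tc_of {M : Type u} [IncLang.Structure M] {m n : ℕ} (hm : 1 ≤ m)
    (hn : 1 ≤ n) (h : TcL m n M) : Tc (ofStr h.1) m n := by
  refine ⟨kf_of _ hm hn h.2.1, ?_, ?_⟩
  · intro F _ hp hc
    obtain ⟨a, a1, a2⟩ := exists_fin F hc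
    obtain ⟨b, b1, b2, b3, -⟩ := h.2.2.1 a a1 (fun i => hp _ ((a2 _).2 ⟨i, rfl⟩))
    refine ⟨Finset.univ.map ⟨b, b1⟩, Set.subset_univ _, by simp, ?_⟩
    intro x hx y hy
    obtain ⟨i, rfl⟩ := (a2 x).1 hx
    obtain ⟨j, -, rfl⟩ := Finset.mem_map.1 hy
    exact b3 i j
  · intro F _ hp hc
    obtain ⟨a, a1, a2⟩ := exists_fin F hc
    obtain ⟨b, b1, b2, b3, -⟩ := h.2.2.2 a a1
      (fun i => (ln_iff h.1 _).2 (hp _ ((a2 _).2 ⟨i, rfl⟩)))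
    refine ⟨Finset.univ.map ⟨b, b1⟩, Set.subset_univ _, by simp, ?_⟩
    intro x hx y hy
    obtain ⟨i, rfl⟩ := (a2 x).1 hx
    obtain ⟨j, -, rfl⟩ := Finset.mem_map.1 hy
    exact b3 j i

theorem ecl_finite {M : Type u} [IncLang.Structure M] {m n : ℕ} (h : IsECL m n M)
    {N : Type u} [IncLang.Structure N] (hN : IsIncidenceL N) (hK : KFreeL m n N)
    (f : M ↪[IncLang] N) {k : ℕ} (xs : Fin k → N) {J : Type*} [Finite J]
    (φ : J → IncLang.BoundedFormula M k) (hφ : ∀ j, (φ j).IsQF) :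
    ∃ ys : Fin k → M, ∀ j, (φ j).Realize (f : M → N) xs ↔ (φ j).Realize (id : M → M) ys := by
  classical
  have : Fintype J := Fintype.ofFinite J
  have key : ∀ s : Finset J, ∃ ψ : IncLang.BoundedFormula M k, ψ.IsQF ∧
      ψ.Realize (f : M → N) xs ∧ ∀ ys : Fin k → M, ψ.Realize (id : M → M) ys →
        ∀ j ∈ s, ((φ j).Realize (f : M → N) xs ↔ (φ j).Realize (id : M → M) ys) := by
    intro s
    induction s using Finset.induction_on with
    | empty => exact ⟨⊤, BoundedFormula.IsQF.top, by simp, by simp⟩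
    | insert j s _ ih =>
      obtain ⟨ψ, h1, h2, h3⟩ := ih
      by_cases hj : (φ j).Realize (f : M → N) xs
      · refine ⟨φ j ⊓ ψ, (hφ j).inf h1, BoundedFormula.realize_inf.2 ⟨hj, h2⟩, ?_⟩
        intro ys hys i hi
        rw [BoundedFormula.realize_inf] at hys
        rcases Finset.mem_insert.1 hi with rfl | hi
        · exact ⟨fun _ => hys.1, fun _ => hj⟩
        · exact h3 ys hys.2 i hi
      · refine ⟨(φ j).not ⊓ ψ, (hφ j).not.inf h1,
          BoundedFormula.realize_inf.2 ⟨BoundedFormula.realize_not.2 hj, h2⟩, ?_⟩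
        intro ys hys i hi
        rw [BoundedFormula.realize_inf, BoundedFormula.realize_not] at hys
        rcases Finset.mem_insert.1 hi with rfl | hi
        · exact ⟨fun h => absurd h hj, fun h => absurd h hys.1⟩
        · exact h3 ys hys.2 i hi
  obtain ⟨ψ, h1, h2, h3⟩ := key Finset.univ
  obtain ⟨ys, hys⟩ := h.2.2 N hN hK f k ψ h1 ⟨xs, h2⟩
  exact ⟨ys, fun j => h3 ys hys j (Finset.mem_univ j)⟩

theorem ec_of {M : Type u} [IncLang.Structure M] {m n : ℕ} (hm : 1 ≤ m) (hn : 1 ≤ n)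
    (h : IsECL m n M) : EC (ofStr h.1) m n := by
  classical
  refine ⟨kf_of _ hm hn h.2.1, ?_⟩
  intro N T hT f hf F B hF hB
  letI := T.toStr
  have hN : IsIncidenceL N := isInc_toStr T
  have hf' : IsE (ofStr h.1) (ofStr hN) f := hf
  have hK : KFreeL m n N := kfree_of hN hT
  have : Finite B := hB
  have : Finite F := hF
  obtain ⟨k, ⟨e⟩⟩ := Finite.exists_equiv_fin B
  let Z := F ⊕ Fin k
  let t : Z → IncLang.Term (M ⊕ Fin k) := Sum.elim (fun a => Term.var (Sum.inl a.1))
    (fun i => Term.var (Sum.inr i))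
  let φ : (Z × Z) ⊕ (Z ⊕ (Z × Z)) → IncLang.BoundedFormula M k :=
    Sum.elim (fun z => (t z.1).bdEqual (t z.2))
      (Sum.elim (fun z => Relations.boundedFormula₁ (L := IncLang) (IncRel.pt : IncLang.Relations 1) (t z))
        (fun z => Relations.boundedFormula₂ (L := IncLang) (IncRel.inc : IncLang.Relations 2) (t z.1) (t z.2)))
  obtain ⟨ys, hys⟩ := ecl_finite h hN hK hf'.emb (fun i => (e.symm i).1) φ (by
    rintro (z | z | z)
    · exact (BoundedFormula.IsAtomic.equal _ _).isQF
    · exact (BoundedFormula.IsAtomic.rel _ _).isQF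
    · exact (BoundedFormula.IsAtomic.rel _ _).isQF)
  have heq : ∀ z z' : Z, (t z).realize (Sum.elim f (fun i => (e.symm i).1)) =
      (t z').realize (Sum.elim f (fun i => (e.symm i).1)) ↔
      (t z).realize (Sum.elim id ys) = (t z').realize (Sum.elim id ys) :=
    fun z z' => hys (Sum.inl (z, z'))
  have hpt : ∀ z : Z, ptL ((t z).realize (Sum.elim f (fun i => (e.symm i).1))) ↔
      ptL ((t z).realize (Sum.elim id ys)) := by
    intro z
    have := hys (Sum.inr (Sum.inl z))
    exact (BoundedFormula.realize_rel₁ (L := IncLang)).symm.trans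
      (this.trans (BoundedFormula.realize_rel₁ (L := IncLang)))
  have hinc : ∀ z z' : Z, incL ((t z).realize (Sum.elim f (fun i => (e.symm i).1)))
      ((t z').realize (Sum.elim f (fun i => (e.symm i).1))) ↔
      incL ((t z).realize (Sum.elim id ys)) ((t z').realize (Sum.elim id ys)) := by
    intro z z'
    have := hys (Sum.inr (Sum.inr (z, z')))
    exact (BoundedFormula.realize_rel₂ (L := IncLang)).symm.trans
      (this.trans (BoundedFormula.realize_rel₂ (L := IncLang)))
  have hb : ∀ b : B, (e.symm (e b)).1 = b.1 := fun b => by rw [e.symm_apply_apply]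
  refine ⟨fun b => ys (e b), ⟨?_, ?_, ?_⟩, ?_⟩
  · intro b c hbc
    have := (heq (Sum.inr (e b)) (Sum.inr (e c))).2 hbc
    simp only [t, Sum.elim_inr, Term.realize_var, hb] at this
    exact Subtype.ext this
  · intro b
    have := hpt (Sum.inr (e b))
    simp only [t, Sum.elim_inr, Term.realize_var, hb] at this
    exact this.symm
  · intro b c
    have := hinc (Sum.inr (e b)) (Sum.inr (e c))
    simp only [t, Sum.elim_inr, Term.realize_var, hb] at this
    exact this.symm
  · intro a ha hfa
    have := heq (Sum.inr (e ⟨f a, hfa⟩)) (Sum.inl ⟨a, ha⟩)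
    simp only [t, Sum.elim_inr, Sum.elim_inl, Term.realize_var, hb] at this
    exact this.1 trivial

theorem qf_local {M N : Type u} [IncLang.Structure M] [IncLang.Structure N]
    (hM : IsIncidenceL M) (hN : IsIncidenceL N) (f : M → N) {k : ℕ}
    (φ : IncLang.BoundedFormula M k) (hφ : φ.IsQF) :
    ∃ F : Finset M, ∀ (B : Type u) (R : Inc B) (p : B → N) (h : B → M), IsE R (ofStr hN) p →
      IsE R (ofStr hM) h → (∀ a ∈ F, ∃ b, p b = f a ∧ h b = a) → ∀ xs : Fin k → B,
        (φ.Realize f (fun i => p (xs i)) ↔ φ.Realize id (fun i => h (xs i))) := by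
  classical
  have term : ∀ t : IncLang.Term (M ⊕ Fin k), ∃ F : Finset M,
      ∀ (B : Type u) (p : B → N) (h : B → M),
      (∀ a ∈ F, ∃ b, p b = f a ∧ h b = a) → ∀ xs : Fin k → B,
      ∃ b, p b = t.realize (Sum.elim f (fun i => p (xs i))) ∧
        h b = t.realize (Sum.elim id (fun i => h (xs i))) := by
    intro t
    rcases t with (a | i) | g
    · exact ⟨{a}, fun B p h hF xs => hF a (Finset.mem_singleton_self a)⟩
    · exact ⟨∅, fun B p h hF xs => ⟨xs i, rfl, rfl⟩⟩
    · exact Empty.elim g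
  induction hφ with
  | falsum => exact ⟨∅, fun _ _ _ _ _ _ _ _ => Iff.rfl⟩
  | of_isAtomic hat =>
    rcases hat with ⟨t1, t2⟩ | ⟨r, ts⟩
    · obtain ⟨F1, h1⟩ := term t1
      obtain ⟨F2, h2⟩ := term t2
      refine ⟨F1 ∪ F2, fun B R p h hp hh hF xs => ?_⟩
      obtain ⟨b, hb, hb'⟩ := h1 B p h (fun a ha => hF a (Finset.mem_union_left _ ha)) xs
      obtain ⟨c, hc, hc'⟩ := h2 B p h (fun a ha => hF a (Finset.mem_union_right _ ha)) xs
      rw [BoundedFormula.realize_bdEqual, BoundedFormula.realize_bdEqual, ← hb, ← hb', ← hc, ← hc',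
        hp.inj.eq_iff, hh.inj.eq_iff]
    · choose F hF using fun i => term (ts i)
      refine ⟨Finset.univ.biUnion F, fun B R p h hp hh hF' xs => ?_⟩
      choose b hb hb' using fun i => hF i B p h
        (fun a ha => hF' a (Finset.mem_biUnion.2 ⟨i, Finset.mem_univ i, ha⟩)) xs
      rw [BoundedFormula.realize_rel, BoundedFormula.realize_rel]
      simp only [← hb, ← hb']
      exact relMap_iff hN hM hp hh r b
  | imp _ _ ih1 ih2 =>
    obtain ⟨F1, h1⟩ := ih1
    obtain ⟨F2, h2⟩ := ih2
    refine ⟨F1 ∪ F2, fun B R p h hp hh hF xs => ?_⟩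
    rw [BoundedFormula.realize_imp, BoundedFormula.realize_imp]
    exact imp_congr (h1 B R p h hp hh (fun a ha => hF a (Finset.mem_union_left _ ha)) xs)
      (h2 B R p h hp hh (fun a ha => hF a (Finset.mem_union_right _ ha)) xs)

theorem ecl_of {M : Type u} [IncLang.Structure M] {m n : ℕ} (hm : 1 ≤ m) (hn : 1 ≤ n)
    (hM : IsIncidenceL M) (h : EC (ofStr hM) m n) : IsECL m n M := by
  classical
  refine ⟨hM, kfree_of hM h.1, ?_⟩
  rintro N _ hN hK f k φ hφ ⟨xs, hxs⟩
  obtain ⟨F, hF⟩ := qf_local hM hN f φ hφ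
  obtain ⟨g, g1, g2⟩ := h.2 N (ofStr hN) (kf_of hN hm hn hK) f (isE_emb hM hN f) F
    (f '' F ∪ Set.range xs) F.finite_toSet
    ((F.finite_toSet.image _).union (Set.finite_range _))
  let ys : Fin k → (f '' F ∪ Set.range xs : Set N) := fun i => ⟨xs i, Or.inr ⟨i, rfl⟩⟩
  refine ⟨fun i => g (ys i), ?_⟩
  refine (hF _ _ Subtype.val g (isE_comap _ Subtype.val_injective) g1 ?_ ys).1 hxs
  intro a ha
  exact ⟨⟨f a, Or.inl ⟨a, ha, rfl⟩⟩, rfl, g2 a ha _⟩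

theorem sim_realize {m n : ℕ} (hm : 1 ≤ m) (hn : 1 ≤ n) {α : Type} [Fintype α] {k : ℕ}
    (φ : IncLang.BoundedFormula α k) :
    ∃ r : ℕ, ∀ (M N : Type u) [IncLang.Structure M] [IncLang.Structure N] (hM : IsIncidenceL M)
      (hN : IsIncidenceL N), EC (ofStr hM) m n → EC (ofStr hN) m n →
      ∀ (v : α → M) (xs : Fin k → M) (w : α → N) (ys : Fin k → N),
        Sim (ofStr hM) (ofStr hN) m n r (Sum.elim v xs) (Sum.elim w ys) →
          (φ.Realize v xs ↔ φ.Realize w ys) := by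
  have term : ∀ {k : ℕ} (t : IncLang.Term (α ⊕ Fin k)), ∃ i, t = Term.var i := by
    intro k t
    rcases t with i | g
    · exact ⟨i, rfl⟩
    · exact Empty.elim g
  induction φ with
  | falsum => exact ⟨0, fun _ _ _ _ _ _ _ _ _ _ _ _ _ => Iff.rfl⟩
  | equal t1 t2 =>
    refine ⟨0, fun M N _ _ hM hN _ _ v xs w ys h => ?_⟩
    obtain ⟨i, rfl⟩ := term t1
    obtain ⟨j, rfl⟩ := term t2
    obtain ⟨X, R, p, q, x, C, hp, hq, -, h1, h2, -⟩ := h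
    show Sum.elim v xs i = Sum.elim v xs j ↔ Sum.elim w ys i = Sum.elim w ys j
    rw [← h1, ← h1, ← h2, ← h2, hp.inj.eq_iff, hq.inj.eq_iff]
  | rel r ts =>
    refine ⟨0, fun M N _ _ hM hN _ _ v xs w ys h => ?_⟩
    choose i hi using fun j => term (ts j)
    obtain ⟨X, R, p, q, x, C, hp, hq, -, h1, h2, -⟩ := h
    have := relMap_iff hM hN hp hq r (fun j => x (i j))
    simp only [h1, h2] at this
    show Structure.RelMap r _ ↔ Structure.RelMap r _
    simp only [hi, Term.realize_var]
    exact this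
  | imp _ _ ih1 ih2 =>
    obtain ⟨r1, h1⟩ := ih1
    obtain ⟨r2, h2⟩ := ih2
    refine ⟨max r1 r2, fun M N _ _ hM hN eM eN v xs w ys h => ?_⟩
    exact imp_congr (h1 M N hM hN eM eN v xs w ys (h.mono (le_max_left _ _)))
      (h2 M N hM hN eM eN v xs w ys (h.mono (le_max_right _ _)))
  | @all k φ ih =>
    obtain ⟨r, hr⟩ := ih
    have snoc : ∀ {P : Type u} (v : α → P) (xs : Fin k → P) (c : P),
        Sum.elim v (Fin.snoc xs c : Fin (k + 1) → P) =
        (fun o : Option (α ⊕ Fin k) => o.elim c (Sum.elim v xs)) ∘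
          (Sum.elim (fun a => some (Sum.inl a))
            (Fin.snoc (α := fun _ => Option (α ⊕ Fin k)) (fun i => some (Sum.inr i)) none)) := by
      intro P v xs c
      funext z
      rcases z with a | i
      · rfl
      · refine Fin.lastCases ?_ (fun i => ?_) i
        · simp
        · simp
    have half : ∀ (M N : Type u) [IncLang.Structure M] [IncLang.Structure N] (hM : IsIncidenceL M)
      (hN : IsIncidenceL N), EC (ofStr hM) m n → EC (ofStr hN) m n →
      ∀ (v : α → M) (xs : Fin k → M) (w : α → N) (ys : Fin k → N),
        Sim (ofStr hM) (ofStr hN) m n ((growF m n)^[r] (Fintype.card (α ⊕ Fin k) + 1) + 1)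
          (Sum.elim v xs) (Sum.elim w ys) →
          (φ.all.Realize w ys → φ.all.Realize v xs) := by
      intro M N _ _ hM hN eM eN v xs w ys h hw c
      obtain ⟨d, hd⟩ := h.forth hm hn eM eN c
      have := hd.reindex (Sum.elim (fun a => some (Sum.inl a))
            (Fin.snoc (α := fun _ => Option (α ⊕ Fin k)) (fun i => some (Sum.inr i)) none))
      rw [← snoc, ← snoc] at this
      exact (hr M N hM hN eM eN _ _ _ _ this).2 (hw d)
    exact ⟨_, fun M N _ _ hM hN eM eN v xs w ys h =>
      ⟨half N M hN hM eN eM w ys v xs h.symm, half M N hM hN eM eN v xs w ys h⟩⟩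


end Inc

/-- If every finite `K_{m,n}`-free incidence structure embeds as an induced
substructure into a finite member of `T^c_{m,n}`, then the common theory of
existentially closed `K_{m,n}`-free incidence structures has a prime model: an
existentially closed `K_{m,n}`-free incidence structure which elementarily embeds
into every existentially closed `K_{m,n}`-free incidence structure. -/
theorem statement_12 (m n : ℕ) (hm : 1 ≤ m) (hn : 1 ≤ n)
    (H : ∀ (A : Type u) (_ : IncLang.Structure A),
      Finite A → IsIncidenceL A → KFreeL m n A →
        ∃ (B : Type u) (_ : IncLang.Structure B), Finite B ∧ TcL m n B ∧
          Nonempty (A ↪[IncLang] B)) :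
    ∃ (M : Type u) (_ : IncLang.Structure M), IsECL m n M ∧
      ∀ (N : Type u) (_ : IncLang.Structure N), IsECL m n N →
        Nonempty (M ↪ₑ[IncLang] N) := by
  have Hy : Inc.St.Hyp.{u} m n := by
    intro A S hA hK
    letI := S.toStr
    obtain ⟨B, iB, hB, hTc, ⟨f⟩⟩ := H A S.toStr hA (Inc.isInc_toStr S)
      (Inc.kfree_of (Inc.isInc_toStr S) hK)
    exact ⟨B, Inc.ofStr hTc.1, f, hB, Inc.tc_of hm hn hTc,
      Inc.isE_emb (Inc.isInc_toStr S) hTc.1 f⟩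
  obtain ⟨M, MS, hEC, hprime⟩ := Inc.St.exists_prime Hy hm hn
  letI := MS.toStr
  refine ⟨M, MS.toStr, Inc.ecl_of hm hn (Inc.isInc_toStr MS) hEC, ?_⟩
  intro N iN hN
  have eN := Inc.ec_of hm hn hN
  obtain ⟨G, hG⟩ := hprime N (Inc.ofStr hN.1) eN
  refine ⟨⟨G, fun k φ x => ?_⟩⟩
  obtain ⟨r, hr⟩ := Inc.sim_realize.{u} hm hn φ
  have hs := hG (Fin k ⊕ Fin 0) (Sum.elim x default) r
  have he : G ∘ Sum.elim x (default : Fin 0 → M) = Sum.elim (G ∘ x) default := by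
    funext z
    rcases z with z | z
    · rfl
    · exact z.elim0
  rw [he] at hs
  exact (hr M N (Inc.isInc_toStr MS) hN.1 hEC eN x default (G ∘ x) default hs).symm
end
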